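/- Let (φ_{t,s})_{s≤t∈I} be an evolution family over parallel slit half-planes (D_t)_{t∈I}, with λ(t) the angular residue of φ_{t,0}. Fix t₀ ∈ I with t₀ < T and write η_{D_{t₀}} := min{Im w : w ∈ ℍ ∖ D_{t₀}}. Then for every η ∈ (0, η_{D_{t₀}}), every z ∈ D_{t₀} with Im z > η, and all s, u ∈ I with t₀ ≤ s ≤ u, one has |φ_{u,t₀}(z) − φ_{s,t₀}(z)| ≤ (12/η)·(λ(u) − λ(s)). In particular, for each fixed t₀, the one-parameter family (φ_{t,t₀})_{t∈I, t≥t₀} is Lipschitz continuous in t with respect to λ, locally uniformly on D_{t₀}. -/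

import Mathlib

open Complex Set Filter Topology Bornology MeasureTheory Metric

noncomputable section

/-- The upper half-plane `ℍ = {z : ℂ | 0 < Im z}`. -/
def UHP : Set ℂ := {z : ℂ | 0 < z.im}

/-- The half-plane `ℍ_η = {z : ℂ | η < Im z}`. -/
def HP (η : ℝ) : Set ℂ := {z : ℂ | η < z.im}

/-- The sector `△_θ = {z : ℂ | θ < arg z < π - θ}`. -/
def Sector (θ : ℝ) : Set ℂ :=
  {z : ℂ | θ < Complex.arg z ∧ Complex.arg z < Real.pi - θ}

/-- A closed horizontal line segment of positive length contained in `ℍ`. -/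
def IsHorizontalSlit (C : Set ℂ) : Prop :=
  ∃ y xl xr : ℝ, 0 < y ∧ xl < xr ∧
    C = {z : ℂ | z.im = y ∧ z.re ∈ Set.Icc xl xr}

/-- A parallel slit half-plane with `N` slits: `ℍ` minus `N` pairwise disjoint
closed horizontal segments of positive length. -/
def IsParallelSlitHalfPlaneN (N : ℕ) (D : Set ℂ) : Prop :=
  ∃ C : Fin N → Set ℂ,
    (∀ j, IsHorizontalSlit (C j)) ∧
    (Pairwise fun i j => Disjoint (C i) (C j)) ∧
    D = UHP \ ⋃ j, C j

/-- A parallel slit half-plane (with some number of slits). -/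
def IsParallelSlitHalfPlane (D : Set ℂ) : Prop :=
  ∃ N : ℕ, IsParallelSlitHalfPlaneN N D

/-- (H.1): hydrodynamic normalization at infinity. -/
def SatisfiesH1 (D : Set ℂ) (f : ℂ → ℂ) : Prop :=
  ∃ η : ℝ, 0 ≤ η ∧ HP η ⊆ D ∧
    Tendsto (fun z => f z - z) (cobounded ℂ ⊓ 𝓟 (HP η)) (𝓝 0)

/-- (H.2): `f` has angular residue `c` at infinity, i.e. `z (f z - z) → -c`
as `z → ∞` within every sector `△_θ`. -/
def SatisfiesH2 (f : ℂ → ℂ) (c : ℂ) : Prop :=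
  ∀ θ : ℝ, 0 < θ → θ < Real.pi / 2 →
    Tendsto (fun z => z * (f z - z)) (cobounded ℂ ⊓ 𝓟 (Sector θ)) (𝓝 (-c))

/-- `F` is an ℍ-hull: relatively closed in `ℍ` with `ℍ \ F` a simply connected
domain. -/
def IsHHull (F : Set ℂ) : Prop :=
  F ⊆ UHP ∧ closure F ∩ UHP ⊆ F ∧
    IsConnected (UHP \ F) ∧ SimplyConnectedSpace ↥(UHP \ F)

/-- `η_D = min {Im w | w ∈ ℍ \ D}`. -/
def etaD (D : Set ℂ) : ℝ := sInf (Complex.im '' (UHP \ D))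

/-- A (chordal) evolution family `φ t s : D s → D t` (for `s ≤ t` in `I`) over
parallel slit half-planes `D t`, where `lam t` is the angular residue of
`φ t 0` at infinity. -/
structure IsEvolutionFamily (I : Set ℝ) (D : ℝ → Set ℂ)
    (φ : ℝ → ℝ → ℂ → ℂ) (lam : ℝ → ℂ) : Prop where
  slit : ∀ t ∈ I, IsParallelSlitHalfPlane (D t)
  mapsTo : ∀ s ∈ I, ∀ t ∈ I, s ≤ t → Set.MapsTo (φ t s) (D s) (D t)
  holo : ∀ s ∈ I, ∀ t ∈ I, s ≤ t → DifferentiableOn ℂ (φ t s) (D s)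
  inj : ∀ s ∈ I, ∀ t ∈ I, s ≤ t → Set.InjOn (φ t s) (D s)
  h1 : ∀ s ∈ I, ∀ t ∈ I, s ≤ t → SatisfiesH1 (D s) (φ t s)
  h2 : ∀ s ∈ I, ∀ t ∈ I, s ≤ t → ∃ c : ℂ, SatisfiesH2 (φ t s) c
  h3 : ∀ s ∈ I, ∀ t ∈ I, s ≤ t → IsHHull (D t \ φ t s '' D s)
  ef1 : ∀ t ∈ I, Set.EqOn (φ t t) id (D t)
  ef2 : ∀ s ∈ I, ∀ t ∈ I, ∀ u ∈ I, s ≤ t → t ≤ u →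
    ∀ z ∈ D s, φ u s z = φ u t (φ t s z)
  lam_res : ∀ t ∈ I, SatisfiesH2 (φ t 0) (lam t)
  ef3 : ContinuousOn lam I

/-- A (chordal) Loewner chain `f t : D t → Dcod` over parallel slit
half-planes `D t` with codomain `Dcod`, where `ell t` is the angular residue
of `f t` at infinity. -/
structure IsLoewnerChain (I : Set ℝ) (D : ℝ → Set ℂ) (Dcod : Set ℂ)
    (f : ℝ → ℂ → ℂ) (ell : ℝ → ℂ) : Prop where
  slit : ∀ t ∈ I, IsParallelSlitHalfPlane (D t)
  slitcod : IsParallelSlitHalfPlane Dcod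
  mapsTo : ∀ t ∈ I, Set.MapsTo (f t) (D t) Dcod
  holo : ∀ t ∈ I, DifferentiableOn ℂ (f t) (D t)
  inj : ∀ t ∈ I, Set.InjOn (f t) (D t)
  h1 : ∀ t ∈ I, SatisfiesH1 (D t) (f t)
  h2 : ∀ t ∈ I, SatisfiesH2 (f t) (ell t)
  h3 : ∀ t ∈ I, IsHHull (Dcod \ f t '' D t)
  lc1 : ∀ s ∈ I, ∀ t ∈ I, s ≤ t → f s '' D s ⊆ f t '' D t
  lc2 : ContinuousOn ell I

/-- `(Lip)_μ`: Lipschitz continuity of `t ↦ f t` w.r.t. the measure `μ`,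
uniformly on compact subsets of `D`. -/
def SatisfiesLip (I : Set ℝ) (μ : Measure ℝ) (D : Set ℂ)
    (f : ℝ → ℂ → ℂ) : Prop :=
  ∀ K : Set ℂ, K ⊆ D → IsCompact K → ∃ L : ℝ,
    ∀ s ∈ I, ∀ t ∈ I, s ≤ t → ∀ z ∈ K,
      ‖f t z - f s z‖ ≤ L * (μ (Set.Ioc s t)).toReal

/-- `(AC)_μ`: absolute continuity of `t ↦ f t` w.r.t. the measure `μ`,
uniformly on compact subsets of `D`. -/
def SatisfiesAC (I : Set ℝ) (μ : Measure ℝ) (D : Set ℂ)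
    (f : ℝ → ℂ → ℂ) : Prop :=
  ∀ K : Set ℂ, K ⊆ D → IsCompact K →
    ∃ ν : Measure ℝ, ν ≪ μ ∧
      (∀ a ∈ I, ∀ b ∈ I, ν (Set.Icc a b) < ⊤) ∧
      ∀ s ∈ I, ∀ t ∈ I, s ≤ t → ∀ z ∈ K,
        ‖f t z - f s z‖ ≤ (ν (Set.Ioc s t)).toReal

/-- The symmetric difference quotient
`(f (t+δ) z - f (t-δ) z) / μ((t-δ, t+δ))`. -/
def symmQuot (μ : Measure ℝ) (f : ℝ → ℂ → ℂ) (t δ : ℝ) (z : ℂ) : ℂ :=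
  (f (t + δ) z - f (t - δ) z) / ((μ (Set.Ioo (t - δ) (t + δ))).toReal : ℂ)

/-- A cross-cut of a domain `G`. -/
def IsCrossCut (G C : Set ℂ) : Prop :=
  ∃ c : ℝ → ℂ, ContinuousOn c (Set.Icc 0 1) ∧ Set.InjOn c (Set.Icc 0 1) ∧
    c 0 ∈ frontier G ∧ c 1 ∈ frontier G ∧ c '' Set.Ioo 0 1 ⊆ G ∧
    C = c '' Set.Icc 0 1

/-- `C` separates `S` from `∞` in `G`: `S` is disjoint from the unbounded
connected component of `G \ C`. -/
def SeparatesFromInfty (G C S : Set ℂ) : Prop :=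
  ∀ z ∈ S ∩ (G \ C), Bornology.IsBounded (connectedComponentIn (G \ C) z)

/-- The local growth property of a family of hulls `(F t)_{t ∈ [0,T]}` in `D`. -/
def LocalGrowth (T : ℝ) (D : Set ℂ) (F : ℝ → Set ℂ) : Prop :=
  ∀ ε : ℝ, 0 < ε → ∃ δ ∈ Set.Ioo 0 T, ∀ t ∈ Set.Icc 0 (T - δ),
    ∃ C : Set ℂ, IsCrossCut (D \ F t) C ∧ Metric.diam C < ε ∧
      SeparatesFromInfty (D \ F t) C (F (t + δ) \ F t)

/-- Carathéodory kernel of a sequence of domains w.r.t. the point `a`. -/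
def kernelAt (a : ℂ) (G : ℕ → Set ℂ) : Set ℂ :=
  connectedComponentIn
    {z : ℂ | ∃ r > 0, ∃ N : ℕ, ∀ n ≥ N, Metric.ball z r ⊆ G n} a

/-- Left continuity in Carathéodory's sense of `(F t)` at `t₀`. -/
def CaratheodoryLeftContinuousAt (D : Set ℂ) (F : ℝ → Set ℂ)
    (T t₀ : ℝ) : Prop :=
  ∀ a ∈ D \ F T, ∀ s : ℕ → ℝ,
    Monotone s → (∀ n, s n ∈ Set.Ico 0 t₀) → Tendsto s atTop (𝓝 t₀) →
      kernelAt a (fun n => D \ F (s n)) = D \ F t₀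

/-- The Joukowski map sending `{1 < ‖ζ‖}` onto the complement of the horizontal segment with
centre `w` and half-length `b`. -/
def slitMap (w : ℂ) (b : ℝ) (ζ : ℂ) : ℂ := w + (b / 2 : ℂ) * (ζ + ζ⁻¹)

/-- The horizontal segment with centre `w` and half-length `b`. -/
def slitSeg (w : ℂ) (b : ℝ) : Set ℂ := {z | z.im = w.im ∧ z.re ∈ Icc (w.re - b) (w.re + b)}

/-- The sum of the distances to the end points of `slitSeg w b`. -/
def focalSum (w : ℂ) (b : ℝ) (z : ℂ) : ℝ := ‖z - (w - b)‖ + ‖z - (w + b)‖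

/-- The closed region bounded by the image of the circle of radius `r` under `slitMap w b`. -/
def slitEllipse (w : ℂ) (b r : ℝ) : Set ℂ := {z | focalSum w b z ≤ b * (r + r⁻¹)}

/-- The open annulus `{r < ‖ζ‖ < R}`. -/
def annulus (r R : ℝ) : Set ℂ := {ζ | r < ‖ζ‖ ∧ ‖ζ‖ < R}

lemma add_inv_lt_add_inv {r s : ℝ} (hr : 1 ≤ r) (hrs : r < s) : r + r⁻¹ < s + s⁻¹ := by
  have hr0 : 0 < r := by linarith
  have hs0 : 0 < s := by linarith
  have h : s + s⁻¹ - (r + r⁻¹) = (s - r) * (r * s - 1) / (r * s) := by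
    field_simp
    ring
  have h2 : 1 < r * s := by nlinarith
  have : 0 < (s - r) * (r * s - 1) / (r * s) := by
    apply div_pos (mul_pos _ _) (mul_pos hr0 hs0) <;> linarith
  linarith

lemma add_inv_lt_iff {r s : ℝ} (hr : 1 ≤ r) (hs : 1 ≤ s) : r + r⁻¹ < s + s⁻¹ ↔ r < s := by
  refine ⟨fun h => ?_, add_inv_lt_add_inv hr⟩
  by_contra! h'
  rcases h'.eq_or_lt with rfl | h''
  · exact lt_irrefl _ h
  · linarith [add_inv_lt_add_inv hs h'']

lemma continuous_focalSum (w : ℂ) (b : ℝ) : Continuous (focalSum w b) := by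
  unfold focalSum
  fun_prop

lemma isClosed_slitEllipse (w : ℂ) (b r : ℝ) : IsClosed (slitEllipse w b r) :=
  isClosed_le (continuous_focalSum w b) continuous_const

lemma isOpen_annulus (r R : ℝ) : IsOpen (annulus r R) :=
  (isOpen_lt continuous_const continuous_norm).inter (isOpen_lt continuous_norm continuous_const)

lemma focalSum_slitMap {w : ℂ} {b : ℝ} (hb : 0 < b) {ζ : ℂ} (hζ : ζ ≠ 0) :
    focalSum w b (slitMap w b ζ) = b * (‖ζ‖ + ‖ζ‖⁻¹) := by
  have h1 : slitMap w b ζ - (w - b) = (b / 2 : ℂ) * ((ζ + 1) ^ 2 * ζ⁻¹) := by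
    unfold slitMap; field_simp; ring
  have h2 : slitMap w b ζ - (w + b) = (b / 2 : ℂ) * ((ζ - 1) ^ 2 * ζ⁻¹) := by
    unfold slitMap; field_simp; ring
  have h3 := parallelogram_law_with_norm ℝ ζ 1
  have hz : 0 < ‖ζ‖ := norm_pos_iff.2 hζ
  unfold focalSum
  rw [h1, h2]
  simp only [norm_mul, norm_pow, norm_inv, norm_div, Complex.norm_real, Real.norm_eq_abs,
    abs_of_pos hb, Complex.norm_ofNat]
  rw [norm_one] at h3
  field_simp
  nlinarith

lemma slitMap_injOn {w : ℂ} {b : ℝ} (hb : 0 < b) : InjOn (slitMap w b) {ζ | 1 < ‖ζ‖} := by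
  intro x hx y hy h
  simp only [mem_ofPred_eq] at hx hy
  have hx0 : x ≠ 0 := by rintro rfl; simp at hx; linarith
  have hy0 : y ≠ 0 := by rintro rfl; simp at hy; linarith
  have hb' : (b : ℂ) ≠ 0 := by exact_mod_cast hb.ne'
  have h1 : (x - y) * (x * y - 1) = 0 := by
    unfold slitMap at h
    field_simp at h
    apply mul_left_cancel₀ hb'
    linear_combination h
  rcases mul_eq_zero.1 h1 with h2 | h2
  · exact sub_eq_zero.1 h2
  · have h3 : ‖x‖ * ‖y‖ = 1 := by rw [← norm_mul, sub_eq_zero.1 h2, norm_one]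
    nlinarith

lemma slitMap_mem_slitSeg {w : ℂ} {b : ℝ} (hb : 0 < b) {ζ : ℂ} (hζ : ‖ζ‖ = 1) :
    slitMap w b ζ ∈ slitSeg w b := by
  have h1 : ζ + ζ⁻¹ = ((2 * ζ.re : ℝ) : ℂ) := by
    rw [Complex.inv_eq_conj hζ, Complex.add_conj]
  have h2 : slitMap w b ζ = w + ((b * ζ.re : ℝ) : ℂ) := by
    unfold slitMap; rw [h1]; push_cast; ring
  have h3 : |ζ.re| ≤ 1 := hζ ▸ Complex.abs_re_le_norm ζ
  rw [abs_le] at h3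
  rw [h2]
  refine ⟨by simp, ?_, ?_⟩ <;> simp only [add_re, ofReal_re] <;> nlinarith

lemma focalSum_of_mem_slitSeg {w : ℂ} {b : ℝ} {z : ℂ} (hz : z ∈ slitSeg w b) :
    focalSum w b z = 2 * b := by
  obtain ⟨h1, h2, h3⟩ := hz
  have e1 : z - (w - b) = ((z.re - w.re + b : ℝ) : ℂ) := by
    apply Complex.ext <;> simp [h1]
    ring
  have e2 : z - (w + b) = ((z.re - w.re - b : ℝ) : ℂ) := by
    apply Complex.ext <;> simp [h1]
    ring
  unfold focalSum
  rw [e1, e2, Complex.norm_real, Complex.norm_real, Real.norm_eq_abs, Real.norm_eq_abs,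
    abs_of_nonneg (by linarith), abs_of_nonpos (by linarith)]
  ring

lemma slitMap_notMem_slitSeg {w : ℂ} {b : ℝ} (hb : 0 < b) {ζ : ℂ} (hζ : 1 < ‖ζ‖) :
    slitMap w b ζ ∉ slitSeg w b := by
  intro h
  have h1 := focalSum_of_mem_slitSeg h
  rw [focalSum_slitMap hb (by rintro rfl; simp at hζ; linarith)] at h1
  have := add_inv_lt_add_inv le_rfl hζ
  nlinarith

lemma exists_slitMap_eq {w : ℂ} {b : ℝ} (hb : 0 < b) {z : ℂ} (hz : z ∉ slitSeg w b) :
    ∃ ζ, 1 < ‖ζ‖ ∧ slitMap w b ζ = z := by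
  have hb' : (b : ℂ) ≠ 0 := by exact_mod_cast hb.ne'
  obtain ⟨s, hs⟩ := IsAlgClosed.exists_pow_nat_eq (((z - w) / b) ^ 2 - 1) (n := 2) (by norm_num)
  have key : ((z - w) / b + s) * ((z - w) / b - s) = 1 := by linear_combination -hs
  have hmain : ∀ x y : ℂ, x * y = 1 → x + y = 2 * ((z - w) / b) → slitMap w b x = z := by
    intro x y hxy hadd
    have : x⁻¹ = y := inv_eq_of_mul_eq_one_right hxy
    unfold slitMap
    rw [this, hadd]
    field_simp
    ring
  have hne : ∀ x, slitMap w b x = z → ‖x‖ ≠ 1 := fun x hx h1 =>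
    hz (hx ▸ slitMap_mem_slitSeg hb h1)
  have e1 := hmain _ _ key (by ring)
  have e2 := hmain _ _ (by rw [mul_comm]; exact key) (by ring)
  have hn : ‖(z - w) / b + s‖ * ‖(z - w) / b - s‖ = 1 := by rw [← norm_mul, key, norm_one]
  rcases lt_trichotomy ‖(z - w) / b + s‖ 1 with h | h | h
  · refine ⟨_, ?_, e2⟩
    by_contra! h'
    nlinarith [norm_nonneg ((z - w) / b + s), norm_nonneg ((z - w) / b - s)]
  · exact absurd h (hne _ e1)
  · exact ⟨_, h, e1⟩

lemma slitEllipse_one {w : ℂ} {b : ℝ} (hb : 0 < b) : slitEllipse w b 1 = slitSeg w b := by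
  ext z
  constructor
  · intro h
    by_contra hz
    obtain ⟨ζ, h1, rfl⟩ := exists_slitMap_eq hb hz
    have := add_inv_lt_add_inv le_rfl h1
    simp only [slitEllipse, mem_ofPred_eq,
      focalSum_slitMap hb (show ζ ≠ 0 by rintro rfl; simp at h1; linarith)] at h
    nlinarith
  · intro h
    simp only [slitEllipse, mem_ofPred_eq, focalSum_of_mem_slitSeg h]
    norm_num
    linarith

lemma isClosed_slitSeg {w : ℂ} {b : ℝ} (hb : 0 < b) : IsClosed (slitSeg w b) :=
  slitEllipse_one hb ▸ isClosed_slitEllipse w b 1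

lemma slitMap_mem_slitEllipse_iff {w : ℂ} {b r : ℝ} (hb : 0 < b) (hr : 1 ≤ r) {ζ : ℂ}
    (hζ : 1 < ‖ζ‖) : slitMap w b ζ ∈ slitEllipse w b r ↔ ‖ζ‖ ≤ r := by
  rw [slitEllipse, mem_ofPred_eq,
    focalSum_slitMap hb (show ζ ≠ 0 by rintro rfl; simp at hζ; linarith),
    mul_le_mul_iff_right₀ hb, ← not_lt, add_inv_lt_iff hr hζ.le, not_lt]

lemma slitSeg_subset_slitEllipse {w : ℂ} {b r : ℝ} (hb : 0 < b) (hr : 1 ≤ r) :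
    slitSeg w b ⊆ slitEllipse w b r := by
  rw [← slitEllipse_one hb]
  intro z hz
  simp only [slitEllipse, mem_ofPred_eq] at hz ⊢
  refine hz.trans (mul_le_mul_of_nonneg_left ?_ hb.le)
  rcases hr.eq_or_lt with rfl | h
  · exact le_rfl
  · exact (add_inv_lt_add_inv le_rfl h).le

lemma exists_mem_slitSeg_dist_le {w : ℂ} {b : ℝ} (hb : 0 < b) {ζ : ℂ} (hζ : 1 < ‖ζ‖) :
    ∃ z ∈ slitSeg w b, dist (slitMap w b ζ) z ≤ b * (‖ζ‖ - 1) := by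
  have h0 : 0 < ‖ζ‖ := by linarith
  have hζ0 : ζ ≠ 0 := norm_pos_iff.1 h0
  have hn : (‖ζ‖ : ℂ) ≠ 0 := by exact_mod_cast h0.ne'
  refine ⟨slitMap w b (ζ / ‖ζ‖), slitMap_mem_slitSeg hb (by simp [hζ0]), ?_⟩
  have e : slitMap w b ζ - slitMap w b (ζ / ‖ζ‖) =
      (b / 2 : ℂ) * (((‖ζ‖ - 1 : ℝ) : ℂ) * (ζ / ‖ζ‖) - ((‖ζ‖ - 1 : ℝ) : ℂ) * ζ⁻¹) := by
    unfold slitMap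
    push_cast
    field_simp
    ring
  rw [dist_eq_norm, e, norm_mul]
  have h1 : ‖((‖ζ‖ - 1 : ℝ) : ℂ) * (ζ / ‖ζ‖) - ((‖ζ‖ - 1 : ℝ) : ℂ) * ζ⁻¹‖ ≤ 2 * (‖ζ‖ - 1) := by
    refine (norm_sub_le _ _).trans ?_
    rw [norm_mul, norm_mul, Complex.norm_real, Real.norm_eq_abs, abs_of_pos (by linarith),
      norm_div, Complex.norm_real, norm_norm, div_self h0.ne', norm_inv]
    have : ‖ζ‖⁻¹ ≤ 1 := inv_le_one_of_one_le₀ hζ.le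
    nlinarith
  have h2 : ‖(b / 2 : ℂ)‖ = b / 2 := by simp [abs_of_pos hb]
  rw [h2]
  nlinarith

lemma differentiableAt_slitMap (w : ℂ) (b : ℝ) {ζ : ℂ} (hζ : ζ ≠ 0) :
    DifferentiableAt ℂ (slitMap w b) ζ := by
  unfold slitMap
  fun_prop (disch := assumption)

lemma isPreconnected_annulus {r R : ℝ} (hr : 0 ≤ r) : IsPreconnected (annulus r R) := by
  have : annulus r R = (fun p : ℝ × ℝ => circleMap 0 p.1 p.2) '' (Ioo r R ×ˢ univ) := by
    ext ζ
    simp only [annulus, mem_ofPred_eq, mem_image, mem_prod, mem_Ioo, mem_univ, and_true, Prod.exists]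
    constructor
    · intro h
      exact ⟨‖ζ‖, ζ.arg, h, by simp [circleMap]⟩
    · rintro ⟨s, θ, h, rfl⟩
      simpa [abs_of_nonneg (hr.trans h.1.le)] using h
  rw [this]
  refine (isPreconnected_Ioo.prod isPreconnected_univ).image _ (Continuous.continuousOn ?_)
  unfold circleMap
  fun_prop

/-- Removing a filled ellipse around a slit does not disconnect an open set. -/
lemma IsPreconnected.diff_slitEllipse {U : Set ℂ} (hU : IsPreconnected U) (hUo : IsOpen U)
    {w : ℂ} {b r R : ℝ} (hb : 0 < b) (hr : 1 ≤ r) (hrR : r < R)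
    (hRU : slitEllipse w b R ⊆ U) : IsPreconnected (U \ slitEllipse w b r) := by
  set K := slitEllipse w b r
  set E := {z | focalSum w b z < b * (R + R⁻¹)}
  have hEo : IsOpen E := isOpen_lt (continuous_focalSum w b) continuous_const
  have hEU : E ⊆ U := fun z hz => by
    simp only [E, mem_ofPred_eq] at hz
    refine hRU ?_
    simp only [slitEllipse, mem_ofPred_eq]
    exact hz.le
  set A := slitMap w b '' annulus r R
  have hA : IsPreconnected A := by
    refine (isPreconnected_annulus (by linarith)).image _ fun ζ hζ => ?_
    refine (differentiableAt_slitMap w b ?_).continuousAt.continuousWithinAt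
    rintro rfl
    have := hζ.1
    simp at this
    linarith
  have hAK : ∀ z ∈ E, z ∉ K → z ∈ A := by
    intro z hz hzK
    obtain ⟨ζ, h1, rfl⟩ := exists_slitMap_eq hb
      (fun h => hzK (slitSeg_subset_slitEllipse hb hr h) : z ∉ slitSeg w b)
    refine ⟨ζ, ⟨?_, ?_⟩, rfl⟩
    · simpa [K, slitMap_mem_slitEllipse_iff hb hr h1] using hzK
    · simp only [E, mem_ofPred_eq] at hz
      rw [focalSum_slitMap hb (show ζ ≠ 0 by rintro rfl; simp at h1; linarith),
        mul_lt_mul_iff_right₀ hb] at hz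
      exact (add_inv_lt_iff h1.le (by linarith)).1 hz
  have hAsub : A ⊆ U \ K := by
    rintro _ ⟨ζ, hζ, rfl⟩
    have h1 : 1 < ‖ζ‖ := lt_of_le_of_lt hr hζ.1
    exact ⟨hRU ((slitMap_mem_slitEllipse_iff hb (by linarith) h1).2 hζ.2.le),
      fun h => absurd hζ.1 (not_lt.2 ((slitMap_mem_slitEllipse_iff hb hr h1).1 h))⟩
  have hKE : K ⊆ E := fun z hz => by
    simp only [K, slitEllipse, mem_ofPred_eq] at hz
    simp only [E, mem_ofPred_eq]
    exact lt_of_le_of_lt hz (mul_lt_mul_of_pos_left (add_inv_lt_add_inv hr hrR) hb)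
  have hWo : IsOpen (U \ K) := hUo.sdiff (isClosed_slitEllipse w b r)
  have main : ∀ u v : Set ℂ, IsOpen u → IsOpen v → u ⊆ U \ K → v ⊆ U \ K → U \ K ⊆ u ∪ v →
      v.Nonempty → A ⊆ u → (u ∩ v).Nonempty := by
    intro u v hu hv huW hvW hcov hvn hAu
    by_cases hun : (U ∩ (u ∪ E)).Nonempty
    · obtain ⟨z, hz⟩ := hU (u ∪ E) v (hu.union hEo) hv (fun z hz => by
        by_cases hzK : z ∈ K
        · exact Or.inl (Or.inr (hKE hzK))
        · rcases hcov ⟨hz, hzK⟩ with h | h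
          · exact Or.inl (Or.inl h)
          · exact Or.inr h) hun (hvn.mono fun z hz => ⟨(hvW hz).1, hz⟩)
      rcases hz.2.1 with h | h
      · exact ⟨z, h, hz.2.2⟩
      · exact ⟨z, hAu (hAK z h (hvW hz.2.2).2), hz.2.2⟩
    · exfalso
      apply hun
      have : w ∈ E := hKE (slitSeg_subset_slitEllipse hb hr (by simp [slitSeg, hb.le]))
      exact ⟨w, hEU this, Or.inr this⟩
  intro u v hu hv hcov hun hvn
  have hu' := hu.inter hWo
  have hv' := hv.inter hWo
  have hcov' : U \ K ⊆ (u ∩ (U \ K)) ∪ (v ∩ (U \ K)) := fun z hz => by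
    rcases hcov hz with h | h
    · exact Or.inl ⟨h, hz⟩
    · exact Or.inr ⟨h, hz⟩
  by_contra hne
  have hdisj : Disjoint (u ∩ (U \ K)) (v ∩ (U \ K)) := by
    rw [Set.disjoint_left]
    exact fun z hz hz' => hne ⟨z, hz.2, hz.1, hz'.1⟩
  rw [inter_comm] at hun hvn
  rcases hA.subset_or_subset hu' hv' hdisj (hAsub.trans hcov') with h | h
  · obtain ⟨z, hz⟩ := main _ _ hu' hv' inter_subset_right inter_subset_right hcov' hvn h
    exact hne ⟨z, hz.1.2, hz.1.1, hz.2.1⟩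
  · obtain ⟨z, hz⟩ := main _ _ hv' hu' inter_subset_right inter_subset_right
      (by rw [union_comm]; exact hcov') hun h
    exact hne ⟨z, hz.1.2, hz.2.1, hz.1.1⟩

/-- The integral computing the winding number of `F` along the circle of radius `r` around `q`. -/
def windInt (F : ℂ → ℂ) (r : ℝ) (q : ℂ) : ℂ := ∮ ζ in C(0, r), deriv F ζ / (F ζ - q)

lemma circleIntegral_eq_of_annulus {f : ℂ → ℂ} {a r ρ R : ℝ} (hf : DifferentiableOn ℂ f (annulus a R))
    (hr0 : 0 < r) (har : a < r) (hr : r ≤ ρ) (hρ : ρ < R) :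
    ∮ ζ in C(0, ρ), f ζ = ∮ ζ in C(0, r), f ζ := by
  have hsub : closedBall (0 : ℂ) ρ \ ball 0 r ⊆ annulus a R := by
    rintro z ⟨h1, h2⟩
    simp only [mem_closedBall, dist_zero_right, mem_ball, not_lt] at h1 h2
    exact ⟨by linarith, by linarith⟩
  refine Complex.circleIntegral_eq_of_differentiable_on_annulus_off_countable hr0 hr
    countable_empty (hf.continuousOn.mono hsub) fun z hz => ?_
  refine (hf z (hsub ?_)).differentiableAt ((isOpen_annulus a R).mem_nhds (hsub ?_))
  all_goals exact ⟨ball_subset_closedBall hz.1.1, fun h => hz.1.2 (ball_subset_closedBall h)⟩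

lemma windInt_eq_zero_of_hasDerivAt {F L : ℂ → ℂ} {r : ℝ} {q : ℂ} (hr : 0 < r)
    (h : ∀ ζ ∈ sphere (0 : ℂ) r, HasDerivAt L (deriv F ζ / (F ζ - q)) ζ) : windInt F r q = 0 :=
  circleIntegral.integral_eq_zero_of_hasDerivWithinAt hr.le fun ζ hζ => (h ζ hζ).hasDerivWithinAt

section

variable {F : ℂ → ℂ} {V : Set ℂ} {r : ℝ}

lemma circleIntegrable_windInt (hV : IsOpen V) (hF : DifferentiableOn ℂ F V) (hr : 0 < r)
    (hs : sphere 0 r ⊆ V) {q : ℂ} (hq : ∀ ζ ∈ sphere (0 : ℂ) r, F ζ ≠ q) :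
    CircleIntegrable (fun ζ => deriv F ζ / (F ζ - q)) 0 r := by
  refine ContinuousOn.circleIntegrable hr.le ?_
  refine ((hF.deriv hV).continuousOn.mono hs).div
    ((hF.continuousOn.mono hs).sub continuousOn_const) fun ζ hζ => sub_ne_zero.2 (hq ζ hζ)

lemma windInt_eq_of_norm_lt (hV : IsOpen V) (hF : DifferentiableOn ℂ F V) (hr : 0 < r)
    (hs : sphere 0 r ⊆ V) {q q' : ℂ} (h : ∀ ζ ∈ sphere (0 : ℂ) r, ‖q - q'‖ < ‖F ζ - q'‖) :
    windInt F r q = windInt F r q' := by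
  have hq' : ∀ ζ ∈ sphere (0 : ℂ) r, F ζ ≠ q' := fun ζ hζ e => by
    have := h ζ hζ
    rw [e, sub_self, norm_zero] at this
    exact (norm_nonneg _).not_gt this
  have hq : ∀ ζ ∈ sphere (0 : ℂ) r, F ζ ≠ q := fun ζ hζ e => by
    have := h ζ hζ
    rw [e] at this
    exact lt_irrefl _ this
  rw [← sub_eq_zero, windInt, windInt, ← circleIntegral.integral_sub
    (circleIntegrable_windInt hV hF hr hs hq) (circleIntegrable_windInt hV hF hr hs hq')]
  refine circleIntegral.integral_eq_zero_of_hasDerivWithinAt hr.le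
    (f := fun ζ => log (1 + (q' - q) / (F ζ - q'))) fun ζ hζ => HasDerivAt.hasDerivWithinAt ?_
  have hd := (hF.differentiableAt (hV.mem_nhds (hs hζ))).hasDerivAt
  have e1 : F ζ - q' ≠ 0 := sub_ne_zero.2 (hq' ζ hζ)
  have e2 : F ζ - q ≠ 0 := sub_ne_zero.2 (hq ζ hζ)
  have e3 : 1 + (q' - q) / (F ζ - q') = (F ζ - q) / (F ζ - q') := by
    field_simp
    ring
  have hm : 1 + (q' - q) / (F ζ - q') ∈ slitPlane := by
    refine mem_slitPlane_of_norm_lt_one ?_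
    rw [norm_div, div_lt_one (norm_pos_iff.2 e1), norm_sub_rev]
    exact h ζ hζ
  have := ((((hasDerivAt_const ζ (q' - q)).div (hd.sub_const q') e1).const_add 1).clog hm)
  refine this.congr_deriv ?_
  simp only [Pi.div_apply]
  rw [e3]
  field_simp
  ring

lemma windInt_eq_zero_of_norm_lt (hV : IsOpen V) (hF : DifferentiableOn ℂ F V) (hr : 0 < r)
    (hs : sphere 0 r ⊆ V) {q : ℂ} (h : ∀ ζ ∈ sphere (0 : ℂ) r, ‖F ζ‖ < ‖q‖) :
    windInt F r q = 0 := by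
  refine windInt_eq_zero_of_hasDerivAt (L := fun ζ => log (1 + -(F ζ / q))) hr fun ζ hζ => ?_
  have hd := (hF.differentiableAt (hV.mem_nhds (hs hζ))).hasDerivAt
  have hq : 0 < ‖q‖ := (norm_nonneg _).trans_lt (h ζ hζ)
  have hq0 : q ≠ 0 := norm_pos_iff.1 hq
  have hm : 1 + -(F ζ / q) ∈ slitPlane := by
    refine mem_slitPlane_of_norm_lt_one ?_
    rw [norm_neg, norm_div, div_lt_one hq]
    exact h ζ hζ
  have hne : F ζ - q ≠ 0 := fun e => by
    have := h ζ hζ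
    rw [sub_eq_zero.1 e] at this
    exact lt_irrefl _ this
  refine ((((hd.div_const q).neg).const_add 1).clog hm).congr_deriv ?_
  have : 1 + -(F ζ / q) = -((F ζ - q) / q) := by field_simp; ring
  simp only [Pi.neg_apply]
  rw [this]
  field_simp

lemma windInt_eq_zero_of_isSimplyConnected (hV : IsOpen V) (hF : DifferentiableOn ℂ F V)
    (hr : 0 < r) (hs : sphere 0 r ⊆ V) {G : Set ℂ} (hGo : IsOpen G) (hG : IsSimplyConnected G)
    (hFG : MapsTo F (sphere 0 r) G) {q : ℂ} (hq : q ∉ G) : windInt F r q = 0 := by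
  obtain ⟨L, hLc, hL⟩ := Complex.exists_continuousOn_eqOn_exp_comp hG hGo
    (g := fun z => z - q) (by fun_prop)
    (by rintro ⟨z, hz, h0⟩; exact hq (sub_eq_zero.1 h0 ▸ hz))
  refine windInt_eq_zero_of_hasDerivAt (L := L ∘ F) hr fun ζ hζ => ?_
  have hd := (hF.differentiableAt (hV.mem_nhds (hs hζ))).hasDerivAt
  have hG' := hFG hζ
  have hexp : exp (L (F ζ)) = F ζ - q := hL hG'
  have hne : F ζ - q ≠ 0 := sub_ne_zero.2 fun e => hq (e ▸ hG')
  have h1 : HasDerivAt (fun z => exp z + q) (F ζ - q) (L (F ζ)) := by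
    rw [← hexp]
    exact (Complex.hasDerivAt_exp _).add_const q
  have h2 : HasDerivAt L (F ζ - q)⁻¹ (F ζ) := by
    refine h1.of_local_left_inverse (hLc.continuousAt (hGo.mem_nhds hG')) hne ?_
    filter_upwards [hGo.mem_nhds hG'] with z hz
    have : exp (L z) = z - q := hL hz
    rw [this, sub_add_cancel]
  exact (h2.comp ζ hd).congr_deriv (by rw [div_eq_inv_mul])

end

/-- The punctured neighbourhoods of the unit circle from outside. -/
def outerNhds : Filter ℂ := comap norm (𝓝[>] 1)

lemma eventually_outerNhds_iff {p : ℂ → Prop} :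
    (∀ᶠ ζ in outerNhds, p ζ) ↔ ∃ r > 1, ∀ ζ ∈ annulus 1 r, p ζ := by
  rw [outerNhds, ((nhdsGT_basis (1 : ℝ)).comap norm).eventually_iff]
  rfl

section

variable {U : Set ℂ} {w : ℂ} {b R : ℝ} {f : ℂ → ℂ}

lemma mapsTo_slitMap_annulus (hb : 0 < b) (hRU : slitEllipse w b R ⊆ U) :
    MapsTo (slitMap w b) (annulus 1 R) (U \ slitSeg w b) := fun _ hζ =>
  ⟨hRU ((slitMap_mem_slitEllipse_iff hb (hζ.1.trans hζ.2).le hζ.1).2 hζ.2.le),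
    slitMap_notMem_slitSeg hb hζ.1⟩

lemma ne_zero_of_mem_annulus {r R : ℝ} (hr : 0 ≤ r) {ζ : ℂ} (hζ : ζ ∈ annulus r R) : ζ ≠ 0 :=
  norm_pos_iff.1 (hr.trans_lt hζ.1)

lemma differentiableOn_comp_slitMap (hb : 0 < b) (hRU : slitEllipse w b R ⊆ U)
    (hf : DifferentiableOn ℂ f (U \ slitSeg w b)) :
    DifferentiableOn ℂ (f ∘ slitMap w b) (annulus 1 R) :=
  hf.comp (fun _ hζ => (differentiableAt_slitMap w b
    (ne_zero_of_mem_annulus zero_le_one hζ)).differentiableWithinAt)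
    (mapsTo_slitMap_annulus hb hRU)

lemma sphere_subset_annulus {a r R : ℝ} (h1 : a < r) (h2 : r < R) :
    sphere (0 : ℂ) r ⊆ annulus a R := fun ζ hζ => by
  rw [mem_sphere_zero_iff_norm] at hζ
  exact ⟨by rw [hζ]; exact h1, by rw [hζ]; exact h2⟩

lemma exists_lt_norm_sub_sphere {F : ℂ → ℂ} {r : ℝ} (hF : ContinuousOn F (sphere 0 r)) {p : ℂ}
    (hp : ∀ ζ ∈ sphere (0 : ℂ) r, F ζ ≠ p) :
    ∃ δ > 0, ∀ ζ ∈ sphere (0 : ℂ) r, δ < ‖F ζ - p‖ := by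
  have hK : IsCompact (F '' sphere 0 r) := (isCompact_sphere 0 r).image_of_continuousOn hF
  have : p ∉ F '' sphere 0 r := by rintro ⟨ζ, h1, h2⟩; exact hp ζ h1 h2
  obtain ⟨δ, hδ, h⟩ := Metric.isOpen_iff.1 hK.isClosed.isOpen_compl p this
  refine ⟨δ / 2, by positivity, fun ζ hζ => ?_⟩
  by_contra! h'
  refine h (show F ζ ∈ ball p δ from ?_) (mem_image_of_mem _ hζ)
  rw [mem_ball, dist_eq_norm]
  linarith

lemma windInt_congr_nhds (hb : 0 < b) (hRU : slitEllipse w b R ⊆ U)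
    (hf : DifferentiableOn ℂ f (U \ slitSeg w b)) (hinj : InjOn f (U \ slitSeg w b))
    (hUo : IsOpen U) {r : ℝ} (hr1 : 1 < r) (hrR : r < R) {a : ℂ}
    (ha : a ∈ U \ slitSeg w b)
    (ha' : ∀ ζ : ℂ, ‖ζ‖ = r → slitMap w b ζ ≠ a) :
    ∀ᶠ a' in 𝓝 a, windInt (f ∘ slitMap w b) r (f a') = windInt (f ∘ slitMap w b) r (f a) := by
  have hF := differentiableOn_comp_slitMap hb hRU hf
  have hs := sphere_subset_annulus hr1 hrR
  obtain ⟨δ, hδ, h⟩ := exists_lt_norm_sub_sphere (hF.continuousOn.mono hs) (p := f a) fun ζ hζ e =>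
    ha' ζ (mem_sphere_zero_iff_norm.1 hζ)
      (hinj (mapsTo_slitMap_annulus hb hRU (hs hζ)) ha e)
  have ho : IsOpen (U \ slitSeg w b) := hUo.sdiff (isClosed_slitSeg hb)
  have hc : ContinuousAt f a := hf.continuousOn.continuousAt (ho.mem_nhds ha)
  filter_upwards [hc.eventually (ball_mem_nhds (f a) hδ)] with a' h'
  refine windInt_eq_of_norm_lt (isOpen_annulus 1 R) hF (by linarith) hs fun ζ hζ => ?_
  rw [dist_eq_norm] at h'
  exact h'.trans (h ζ hζ)

lemma isBounded_slitEllipse (w : ℂ) (b r : ℝ) : IsBounded (slitEllipse w b r) := by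
  refine (isBounded_closedBall (x := w - b) (r := b * (r + r⁻¹))).subset fun z hz => ?_
  simp only [slitEllipse, mem_ofPred_eq, focalSum] at hz
  rw [mem_closedBall, dist_eq_norm]
  linarith [norm_nonneg (z - (w + b))]

lemma windInt_eq_zero_of_notMem_slitEllipse (hU : IsPreconnected U) (hUo : IsOpen U) (hb : 0 < b)
    (hRU : slitEllipse w b R ⊆ U) (hf : DifferentiableOn ℂ f (U \ slitSeg w b))
    (hinj : InjOn f (U \ slitSeg w b)) {z : ℕ → ℂ} (hz : ∀ n, z n ∈ U \ slitSeg w b)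
    (hz' : Tendsto z atTop (cobounded ℂ)) (hfz : Tendsto (fun n => f (z n)) atTop (cobounded ℂ))
    {r : ℝ} (hr1 : 1 < r) (hrR : r < R) {a : ℂ}
    (ha : a ∈ U \ slitEllipse w b r) : windInt (f ∘ slitMap w b) r (f a) = 0 := by
  have hF := differentiableOn_comp_slitMap hb hRU hf
  have hs := sphere_subset_annulus hr1 hrR
  have hsub : U \ slitEllipse w b r ⊆ U \ slitSeg w b :=
    sdiff_subset_sdiff_right (slitSeg_subset_slitEllipse hb hr1.le)
  have hpre := hU.diff_slitEllipse hUo hb hr1.le hrR hRU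
  obtain ⟨M, hM⟩ := ((isCompact_sphere (0 : ℂ) r).image_of_continuousOn
    (hF.continuousOn.mono hs)).isBounded.exists_norm_le
  have h1 : ∀ᶠ n in atTop, z n ∉ slitEllipse w b r :=
    hz'.eventually (isBounded_def.1 (isBounded_slitEllipse w b r))
  have h2 : ∀ᶠ n in atTop, M < ‖f (z n)‖ :=
    (tendsto_norm_cobounded_atTop.comp hfz).eventually_gt_atTop M
  obtain ⟨n, hn1, hn2⟩ := (h1.and h2).exists
  have key := hpre.induction₂
    (fun x y => windInt (f ∘ slitMap w b) r (f x) = windInt (f ∘ slitMap w b) r (f y))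
    (fun x hx => mem_nhdsWithin_of_mem_nhds (by
      filter_upwards [windInt_congr_nhds hb hRU hf hinj hUo hr1 hrR (hsub hx) fun ζ hζ e =>
        hx.2 (e ▸ (slitMap_mem_slitEllipse_iff hb hr1.le (hζ ▸ hr1)).2 hζ.le)] with y hy
      exact hy.symm))
    (fun x y z _ _ _ h h' => h.trans h') (fun x y _ _ h => h.symm) ha ⟨(hz n).1, hn1⟩
  rw [key]
  refine windInt_eq_zero_of_norm_lt (isOpen_annulus 1 R) hF (by linarith) hs fun ζ hζ => ?_
  exact (hM _ (mem_image_of_mem _ hζ)).trans_lt hn2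

lemma windInt_ne_zero_of_deriv_ne_zero (hU : IsPreconnected U) (hUo : IsOpen U) (hb : 0 < b)
    (hRU : slitEllipse w b R ⊆ U) (hf : DifferentiableOn ℂ f (U \ slitSeg w b))
    (hinj : InjOn f (U \ slitSeg w b)) {z : ℕ → ℂ} (hz : ∀ n, z n ∈ U \ slitSeg w b)
    (hz' : Tendsto z atTop (cobounded ℂ)) (hfz : Tendsto (fun n => f (z n)) atTop (cobounded ℂ))
    {ρ : ℝ} (hρR : ρ < R) {α : ℂ} (hα : 1 < ‖α‖)
    (hαρ : ‖α‖ < ρ) (hd : deriv (f ∘ slitMap w b) α ≠ 0) :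
    windInt (f ∘ slitMap w b) ρ (f (slitMap w b α)) ≠ 0 := by
  set F := f ∘ slitMap w b with hFdef
  have hF : DifferentiableOn ℂ F (annulus 1 R) := differentiableOn_comp_slitMap hb hRU hf
  have hFinj : InjOn F (annulus 1 R) :=
    hinj.comp ((slitMap_injOn hb).mono fun ζ hζ => hζ.1) (mapsTo_slitMap_annulus hb hRU)
  have hαA : α ∈ annulus 1 R := ⟨hα, hαρ.trans hρR⟩
  have hopen := isOpen_annulus 1 R
  obtain ⟨r, hr1, hrα⟩ := exists_between hα
  set S := dslope F α
  have hS : DifferentiableOn ℂ S (annulus 1 R) :=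
    (Complex.differentiableOn_dslope (hopen.mem_nhds hαA)).2 hF
  have hS0 : ∀ ζ ∈ annulus 1 R, S ζ ≠ 0 := by
    intro ζ hζ
    by_cases h : ζ = α
    · simpa only [S, h, dslope_same] using hd
    · simp only [S, dslope_of_ne _ h, slope_def_field]
      exact div_ne_zero (sub_ne_zero.2 fun e => h (hFinj hζ hαA e)) (sub_ne_zero.2 h)
  have hH : DifferentiableOn ℂ (fun ζ => deriv S ζ / S ζ) (annulus 1 R) :=
    (hS.deriv hopen).div hS hS0
  have hdec : ∀ t, 1 < t → t < R → t ≠ ‖α‖ →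
      windInt F t (F α) = (∮ ζ in C(0, t), (ζ - α)⁻¹) + ∮ ζ in C(0, t), deriv S ζ / S ζ := by
    intro t ht1 htR htα
    have hs := sphere_subset_annulus ht1 htR
    have hne : ∀ ζ ∈ sphere (0 : ℂ) t, ζ - α ≠ 0 := fun ζ hζ e => htα (by
      rw [mem_sphere_zero_iff_norm] at hζ
      rw [← hζ, sub_eq_zero.1 e])
    rw [windInt, ← circleIntegral.integral_add]
    · refine circleIntegral.integral_congr (by linarith) fun ζ hζ => ?_
      have hζα := hne ζ hζ
      have h1 : F = fun z => F α + (z - α) * S z := by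
        ext z
        have := sub_smul_dslope F α z
        rw [smul_eq_mul] at this
        simp only [S, this]
        ring
      have hdS := (hS.differentiableAt (hopen.mem_nhds (hs hζ))).hasDerivAt
      have h2 : deriv F ζ = S ζ + (ζ - α) * deriv S ζ := by
        have := (((hasDerivAt_id ζ).sub_const α).mul hdS).const_add (F α)
        have h3 : deriv F ζ = 1 * S ζ + (id ζ - α) * deriv S ζ := by
          conv_lhs => rw [h1]
          exact this.deriv
        simpa using h3
      have h3 : F ζ - F α = (ζ - α) * S ζ := by
        have := sub_smul_dslope F α ζ
        rw [smul_eq_mul] at this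
        exact this.symm
      have h4 := hS0 ζ (hs hζ)
      simp only [h2, h3]
      field_simp
    · refine ContinuousOn.circleIntegrable (by linarith) ?_
      exact (continuousOn_id.sub continuousOn_const).inv₀ hne
    · exact ContinuousOn.circleIntegrable (by linarith) (hH.continuousOn.mono hs)
  have e1 := hdec r hr1 (by linarith) hrα.ne
  have e2 := hdec ρ (by linarith) hρR hαρ.ne'
  have e3 : windInt F r (F α) = 0 := windInt_eq_zero_of_notMem_slitEllipse hU hUo hb hRU hf hinj
    hz hz' hfz hr1 (by linarith) ⟨(mapsTo_slitMap_annulus hb hRU hαA).1, fun h =>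
      absurd ((slitMap_mem_slitEllipse_iff hb hr1.le hα).1 h) (not_le.2 hrα)⟩
  have e4 : ∮ ζ in C(0, r), (ζ - α)⁻¹ = 0 := by
    refine Complex.circleIntegral_eq_zero_of_differentiable_on_off_countable (by linarith)
      countable_empty ?_ ?_
    · refine (continuousOn_id.sub continuousOn_const).inv₀ fun ζ hζ e => ?_
      rw [mem_closedBall_zero_iff, show ζ = α from sub_eq_zero.1 e] at hζ
      linarith
    · intro ζ hζ
      refine (differentiableAt_id.sub_const α).inv fun e => ?_
      have := hζ.1
      rw [mem_ball_zero_iff, show ζ = α from sub_eq_zero.1 e] at this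
      linarith
  have e5 : ∮ ζ in C(0, ρ), (ζ - α)⁻¹ = 2 * Real.pi * I :=
    circleIntegral.integral_sub_inv_of_mem_ball (by simpa using hαρ)
  have e6 := circleIntegral_eq_of_annulus hH (by linarith) hr1 (hrα.trans hαρ).le hρR
  rw [e4, e3, zero_add] at e1
  change windInt F ρ (F α) ≠ 0
  rw [e2, e5, e6, ← e1, add_zero]
  simp [Real.pi_ne_zero]

lemma windInt_ne_zero (hU : IsPreconnected U) (hUo : IsOpen U) (hb : 0 < b)
    (hRU : slitEllipse w b R ⊆ U) (hf : DifferentiableOn ℂ f (U \ slitSeg w b))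
    (hinj : InjOn f (U \ slitSeg w b)) {z : ℕ → ℂ} (hz : ∀ n, z n ∈ U \ slitSeg w b)
    (hz' : Tendsto z atTop (cobounded ℂ)) (hfz : Tendsto (fun n => f (z n)) atTop (cobounded ℂ))
    {ρ : ℝ} (hρR : ρ < R) {α : ℂ} (hα : 1 < ‖α‖)
    (hαρ : ‖α‖ < ρ) : windInt (f ∘ slitMap w b) ρ (f (slitMap w b α)) ≠ 0 := by
  set F := f ∘ slitMap w b with hFdef
  have hF : DifferentiableOn ℂ F (annulus 1 R) := differentiableOn_comp_slitMap hb hRU hf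
  have hFinj : InjOn F (annulus 1 R) :=
    hinj.comp ((slitMap_injOn hb).mono fun ζ hζ => hζ.1) (mapsTo_slitMap_annulus hb hRU)
  have hαA : α ∈ annulus 1 ρ := ⟨hα, hαρ⟩
  have hαR : α ∈ annulus 1 R := ⟨hα, hαρ.trans hρR⟩
  have h1 := windInt_congr_nhds hb hRU hf hinj hUo (hα.trans hαρ) hρR
    (mapsTo_slitMap_annulus hb hRU hαR) fun ζ hζ e => by
      have := slitMap_injOn hb (show ζ ∈ {ζ : ℂ | 1 < ‖ζ‖} from by
        rw [mem_ofPred_eq, hζ]; exact hα.trans hαρ) (show α ∈ {ζ : ℂ | 1 < ‖ζ‖} from hα) e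
      rw [this] at hζ
      exact hαρ.ne hζ
  have h2 := (differentiableAt_slitMap w b
    (ne_zero_of_mem_annulus zero_le_one hαA)).continuousAt.eventually h1
  have h3 := (isOpen_annulus 1 ρ).mem_nhds hαA
  by_contra hcon
  have h4 : ∀ᶠ β in 𝓝 α, deriv F β = 0 := by
    filter_upwards [h2, h3] with β hβ hβ'
    by_contra h
    exact windInt_ne_zero_of_deriv_ne_zero hU hUo hb hRU hf hinj hz hz' hfz hρR hβ'.1 hβ'.2 h
      (hβ.trans hcon)
  obtain ⟨ε, hε, hball⟩ := Metric.eventually_nhds_iff_ball.1 (h4.and ((isOpen_annulus 1 R).mem_nhds hαR))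
  have h5 : ∀ x ∈ ball α ε, ∀ y ∈ ball α ε, F x = F y := fun x hx y hy =>
    IsOpen.is_const_of_deriv_eq_zero isOpen_ball (convex_ball α ε).isPreconnected
      (hF.mono fun β hβ => (hball β hβ).2) (fun β hβ => (hball β hβ).1) hx hy
  have hx : α + (ε / 2 : ℝ) ∈ ball α ε := by
    rw [mem_ball, dist_eq_norm, add_sub_cancel_left, Complex.norm_real, Real.norm_eq_abs,
      abs_of_pos (by positivity)]
    linarith
  have := hFinj (hball _ hx).2 hαR (h5 _ hx _ (mem_ball_self hε))
  rw [add_eq_left, Complex.ofReal_eq_zero] at this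
  linarith

lemma exists_norm_le_annulus (hU : IsPreconnected U) (hUo : IsOpen U) (hb : 0 < b)
    (hRU : slitEllipse w b R ⊆ U) (hf : DifferentiableOn ℂ f (U \ slitSeg w b))
    (hinj : InjOn f (U \ slitSeg w b)) {z : ℕ → ℂ} (hz : ∀ n, z n ∈ U \ slitSeg w b)
    (hz' : Tendsto z atTop (cobounded ℂ)) (hfz : Tendsto (fun n => f (z n)) atTop (cobounded ℂ))
    {ρ : ℝ} (hρ1 : 1 < ρ) (hρR : ρ < R) :
    ∃ M, ∀ α ∈ annulus 1 ρ, ‖f (slitMap w b α)‖ ≤ M := by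
  have hF := differentiableOn_comp_slitMap hb hRU hf
  have hs := sphere_subset_annulus hρ1 hρR
  obtain ⟨M, hM⟩ := ((isCompact_sphere (0 : ℂ) ρ).image_of_continuousOn
    (hF.continuousOn.mono hs)).isBounded.exists_norm_le
  refine ⟨M, fun α hα => ?_⟩
  by_contra! h
  exact windInt_ne_zero hU hUo hb hRU hf hinj hz hz' hfz hρR hα.1 hα.2
    (windInt_eq_zero_of_norm_lt (isOpen_annulus 1 R) hF (by linarith) hs fun ζ hζ =>
      (hM _ (mem_image_of_mem _ hζ)).trans_lt h)

lemma exists_le_norm_sub_annulus (hU : IsPreconnected U) (hUo : IsOpen U) (hb : 0 < b)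
    (hRU : slitEllipse w b R ⊆ U) (hf : DifferentiableOn ℂ f (U \ slitSeg w b))
    (hinj : InjOn f (U \ slitSeg w b)) {z : ℕ → ℂ} (hz : ∀ n, z n ∈ U \ slitSeg w b)
    (hz' : Tendsto z atTop (cobounded ℂ)) (hfz : Tendsto (fun n => f (z n)) atTop (cobounded ℂ))
    {ρ : ℝ} (hρ1 : 1 < ρ) (hρR : ρ < R) {G : Set ℂ} (hGo : IsOpen G)
    (hG : IsSimplyConnected G) (hfG : MapsTo f (U \ slitSeg w b) G) {p : ℂ} (hp : p ∉ G) :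
    ∃ δ > 0, ∀ α ∈ annulus 1 ρ, δ ≤ ‖f (slitMap w b α) - p‖ := by
  have hF := differentiableOn_comp_slitMap hb hRU hf
  have hs := sphere_subset_annulus hρ1 hρR
  have hFG : MapsTo (f ∘ slitMap w b) (sphere 0 ρ) G := fun ζ hζ =>
    hfG (mapsTo_slitMap_annulus hb hRU (hs hζ))
  obtain ⟨δ, hδ, h⟩ := exists_lt_norm_sub_sphere (hF.continuousOn.mono hs) (p := p)
    fun ζ hζ e => hp (e ▸ hFG hζ)
  refine ⟨δ, hδ, fun α hα => ?_⟩
  by_contra! h'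
  refine windInt_ne_zero hU hUo hb hRU hf hinj hz hz' hfz hρR hα.1 hα.2 ?_
  rw [windInt_eq_of_norm_lt (isOpen_annulus 1 R) hF (by linarith) hs (q' := p)
    fun ζ hζ => h'.trans (h ζ hζ)]
  exact windInt_eq_zero_of_isSimplyConnected (isOpen_annulus 1 R) hF (by linarith) hs hGo hG hFG hp

end

lemma isCompact_slitEllipse (w : ℂ) (b r : ℝ) : IsCompact (slitEllipse w b r) :=
  isCompact_of_isClosed_isBounded (isClosed_slitEllipse w b r) (isBounded_slitEllipse w b r)

lemma isCompact_slitSeg {w : ℂ} {b : ℝ} (hb : 0 < b) : IsCompact (slitSeg w b) :=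
  slitEllipse_one hb ▸ isCompact_slitEllipse w b 1

lemma eventually_slitEllipse_subset {w : ℂ} {b : ℝ} (hb : 0 < b) {V : Set ℂ} (hV : IsOpen V)
    (h : slitSeg w b ⊆ V) : ∀ᶠ ρ in 𝓝[>] (1 : ℝ), slitEllipse w b ρ ⊆ V := by
  obtain ⟨δ, hδ, hsub⟩ := (isCompact_slitSeg hb).exists_cthickening_subset_open hV h
  filter_upwards [Ioo_mem_nhdsGT (show (1 : ℝ) < 1 + δ / b by linarith [div_pos hδ hb])] with ρ hρ
  intro z hz
  by_cases hs : z ∈ slitSeg w b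
  · exact h hs
  · obtain ⟨ζ, h1, rfl⟩ := exists_slitMap_eq hb hs
    rw [slitMap_mem_slitEllipse_iff hb hρ.1.le h1] at hz
    obtain ⟨y, hy, hd⟩ := exists_mem_slitSeg_dist_le (w := w) hb h1
    refine hsub (mem_cthickening_of_dist_le _ y δ _ hy (hd.trans ?_))
    have : ‖ζ‖ - 1 ≤ δ / b := by linarith [hρ.2]
    rwa [le_div_iff₀' hb] at this

lemma eventually_notMem_slitEllipse {w : ℂ} {b : ℝ} (hb : 0 < b) {z : ℂ} (hz : z ∉ slitSeg w b) :
    ∀ᶠ ρ in 𝓝[>] (1 : ℝ), z ∉ slitEllipse w b ρ := by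
  filter_upwards [eventually_slitEllipse_subset hb (isOpen_compl_singleton (x := z))
    (fun y hy e => hz (e ▸ hy))] with ρ h hzρ
  exact h hzρ rfl

lemma eventually_disjoint_slitEllipse {w w' : ℂ} {b b' : ℝ} (hb : 0 < b) (hb' : 0 < b')
    (h : Disjoint (slitSeg w b) (slitSeg w' b')) :
    ∀ᶠ ρ in 𝓝[>] (1 : ℝ), Disjoint (slitEllipse w b ρ) (slitEllipse w' b' ρ) := by
  obtain ⟨V, V', hV, hV', h1, h2, hd⟩ :=
    SeparatedNhds.of_isCompact_isCompact (isCompact_slitSeg hb) (isCompact_slitSeg hb') h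
  filter_upwards [eventually_slitEllipse_subset hb hV h1,
    eventually_slitEllipse_subset hb' hV' h2] with ρ h3 h4
  exact hd.mono h3 h4

/-- Centres `w j` and half-lengths `b j` of pairwise disjoint horizontal slits in `ℍ`. -/
structure IsSlitFamily {N : ℕ} (w : Fin N → ℂ) (b : Fin N → ℝ) : Prop where
  pos : ∀ j, 0 < b j
  im_pos : ∀ j, 0 < (w j).im
  disj : Pairwise fun i j => Disjoint (slitSeg (w i) (b i)) (slitSeg (w j) (b j))

/-- The upper half-plane without the given horizontal slits. -/
def slitDomain {N : ℕ} (w : Fin N → ℂ) (b : Fin N → ℝ) : Set ℂ :=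
  UHP \ ⋃ j, slitSeg (w j) (b j)

lemma IsParallelSlitHalfPlane.exists_isSlitFamily {D : Set ℂ} (h : IsParallelSlitHalfPlane D) :
    ∃ (N : ℕ) (w : Fin N → ℂ) (b : Fin N → ℝ), IsSlitFamily w b ∧ D = slitDomain w b := by
  obtain ⟨N, C, h1, h2, h3⟩ := h
  choose y xl xr hy hx hC using h1
  have key : ∀ j, C j = slitSeg ⟨(xl j + xr j) / 2, y j⟩ ((xr j - xl j) / 2) := by
    intro j
    rw [hC j]
    unfold slitSeg
    congr! 5
    · ring
    · ring
  refine ⟨N, fun j => ⟨(xl j + xr j) / 2, y j⟩, fun j => (xr j - xl j) / 2, ⟨fun j => ?_, fun j => ?_, ?_⟩, ?_⟩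
  · linarith [hx j]
  · exact hy j
  · intro i j hij
    have : Disjoint (C i) (C j) := h2 hij
    rwa [key i, key j] at this
  · rw [h3]
    unfold slitDomain
    simp_rw [key]

lemma isOpen_HP (a : ℝ) : IsOpen (HP a) := isOpen_lt continuous_const continuous_im

lemma isOpen_UHP : IsOpen UHP := isOpen_HP 0

lemma isPreconnected_HP (a : ℝ) : IsPreconnected (HP a) := by
  have : HP a = imCLM ⁻¹' Ioi a := rfl
  rw [this]
  exact ((convex_Ioi a).linear_preimage imCLM.toLinearMap).isPreconnected

section

variable {N : ℕ} {w : Fin N → ℂ} {b : Fin N → ℝ}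

lemma slitSeg_subset_HP {w : ℂ} {b a : ℝ} (h : a < w.im) : slitSeg w b ⊆ HP a := fun z hz => by
  have := hz.1
  simp only [HP, mem_ofPred_eq]
  linarith

lemma IsSlitFamily.isClosed_iUnion (h : IsSlitFamily w b) (s : Set (Fin N)) :
    IsClosed (⋃ j ∈ s, slitSeg (w j) (b j)) :=
  s.toFinite.isClosed_biUnion fun j _ => isClosed_slitSeg (h.pos j)

lemma IsSlitFamily.isOpen_HP_diff (h : IsSlitFamily w b) (a : ℝ) (s : Set (Fin N)) :
    IsOpen (HP a \ ⋃ j ∈ s, slitSeg (w j) (b j)) :=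
  (isOpen_HP a).sdiff (h.isClosed_iUnion s)

lemma IsSlitFamily.slitSeg_subset_diff (h : IsSlitFamily w b) {a : ℝ}
    {s : Set (Fin N)} {j : Fin N} (ha : a < (w j).im) (hj : j ∉ s) :
    slitSeg (w j) (b j) ⊆ HP a \ ⋃ j ∈ s, slitSeg (w j) (b j) := fun z hz =>
  ⟨slitSeg_subset_HP ha hz, fun h' => by
    simp only [mem_iUnion] at h'
    obtain ⟨i, hi, hzi⟩ := h'
    exact Set.disjoint_left.1 (h.disj (fun e => hj (e ▸ hi) : i ≠ j)) hzi hz⟩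

lemma IsSlitFamily.isPreconnected_HP_diff (h : IsSlitFamily w b) {a : ℝ} (ha : ∀ j, a < (w j).im)
    (s : Set (Fin N)) : IsPreconnected (HP a \ ⋃ j ∈ s, slitSeg (w j) (b j)) := by
  induction s, s.toFinite using Set.Finite.induction_on with
  | empty => simpa using isPreconnected_HP a
  | @insert j s hj _ ih =>
    obtain ⟨R, h1, h2⟩ := ((eventually_slitEllipse_subset (h.pos j) (h.isOpen_HP_diff a s)
      (h.slitSeg_subset_diff (ha j) hj)).and self_mem_nhdsWithin).exists
    have := ih.diff_slitEllipse (h.isOpen_HP_diff a s) (h.pos j) le_rfl h2 h1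
    rw [biUnion_insert]
    rwa [slitEllipse_one (h.pos j), sdiff_sdiff, union_comm] at this

lemma IsSlitFamily.isOpen_slitDomain (h : IsSlitFamily w b) : IsOpen (slitDomain w b) := by
  have := h.isOpen_HP_diff 0 univ
  rwa [biUnion_univ] at this

/-- The upper half-plane with all slits but the `j`-th one removed. -/
def slitDomainExcept (w : Fin N → ℂ) (b : Fin N → ℝ) (j : Fin N) : Set ℂ :=
  HP 0 \ ⋃ i ∈ ({j}ᶜ : Set (Fin N)), slitSeg (w i) (b i)

lemma slitDomainExcept_diff (w : Fin N → ℂ) (b : Fin N → ℝ) (j : Fin N) :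
    slitDomainExcept w b j \ slitSeg (w j) (b j) = slitDomain w b := by
  have h : insert j ({j}ᶜ : Set (Fin N)) = univ := by
    rw [insert_eq, union_compl_self]
  have h' := biUnion_insert j ({j}ᶜ : Set (Fin N)) fun i => slitSeg (w i) (b i)
  rw [slitDomainExcept, sdiff_sdiff, union_comm, ← h', h, biUnion_univ]
  rfl

lemma IsSlitFamily.eventually_slitEllipse_subset_except (h : IsSlitFamily w b) (j : Fin N) :
    ∀ᶠ ρ in 𝓝[>] (1 : ℝ), slitEllipse (w j) (b j) ρ ⊆ slitDomainExcept w b j :=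
  eventually_slitEllipse_subset (h.pos j) (h.isOpen_HP_diff 0 _)
    (h.slitSeg_subset_diff (h.im_pos j) (by simp))

end

lemma IsHHull.isOpen {F : Set ℂ} (h : IsHHull F) : IsOpen (UHP \ F) := by
  have : UHP \ F = UHP \ closure F := by
    ext z
    refine ⟨fun hz => ⟨hz.1, fun h' => hz.2 (h.2.1 ⟨h', hz.1⟩)⟩, fun hz => ⟨hz.1, fun h' =>
      hz.2 (subset_closure h')⟩⟩
  rw [this]
  exact isOpen_UHP.sdiff isClosed_closure

lemma tendsto_mul_I_cobounded {y : ℕ → ℝ} (hy : Tendsto y atTop atTop) :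
    Tendsto (fun n => (y n : ℂ) * I) atTop (cobounded ℂ) := by
  rw [← tendsto_norm_atTop_iff_cobounded]
  simp only [norm_mul, Complex.norm_real, norm_I, mul_one]
  exact tendsto_norm_atTop_atTop.comp hy

lemma SatisfiesH1.exists_seq {D : Set ℂ} {f : ℂ → ℂ} (h : SatisfiesH1 D f) :
    ∃ z : ℕ → ℂ, (∀ n, z n ∈ D) ∧ Tendsto z atTop (cobounded ℂ) ∧
      Tendsto (fun n => f (z n)) atTop (cobounded ℂ) := by
  obtain ⟨η, h0, hD, hlim⟩ := h
  set y : ℕ → ℝ := fun n => n + (η + 1)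
  have hy : Tendsto y atTop atTop :=
    tendsto_atTop_add_const_right _ _ tendsto_natCast_atTop_atTop
  have hz := tendsto_mul_I_cobounded hy
  have hm : ∀ n, (y n : ℂ) * I ∈ HP η := fun n => by
    simp only [HP, mem_ofPred_eq, y]
    simp
    linarith [(Nat.cast_nonneg n : (0 : ℝ) ≤ n)]
  refine ⟨fun n => (y n : ℂ) * I, fun n => hD (hm n), hz, ?_⟩
  have h1 : Tendsto (fun n => f (y n * I) - y n * I) atTop (𝓝 0) :=
    hlim.comp (tendsto_inf.2 ⟨hz, tendsto_principal.2 (Eventually.of_forall hm)⟩)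
  rw [← tendsto_norm_atTop_iff_cobounded] at hz ⊢
  have h2 : Tendsto (fun n => ‖(y n : ℂ) * I‖ + -‖f (y n * I) - y n * I‖) atTop atTop :=
    tendsto_atTop_add_right_of_le' _ (-1) hz (by
      filter_upwards [h1.norm.eventually (gt_mem_nhds (show ‖(0 : ℂ)‖ < 1 by simp))] with n hn
      linarith)
  refine tendsto_atTop_mono (fun n => ?_) h2
  have := norm_sub_norm_le (y n * I) (f (y n * I))
  rw [norm_sub_rev (y n * I)] at this
  linarith

lemma exists_pos_forall_le_dist {ι : Type*} [Finite ι] (c : ι → ℝ) :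
    ∃ δ > 0, ∀ i j, c i ≠ c j → δ ≤ |c i - c j| := by
  have : ∀ᶠ δ in 𝓝[>] (0 : ℝ), ∀ i j, c i ≠ c j → δ ≤ |c i - c j| := by
    refine eventually_all.2 fun i => eventually_all.2 fun j => ?_
    by_cases h : c i = c j
    · exact Eventually.of_forall fun _ h' => absurd h h'
    · filter_upwards [Ioo_mem_nhdsGT (abs_pos.2 (sub_ne_zero.2 h))] with δ hδ _
      exact hδ.2.le
  obtain ⟨δ, h1, h2⟩ := (this.and self_mem_nhdsWithin).exists
  exact ⟨δ, h2, h1⟩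

lemma annulus_nonempty {r : ℝ} (hr : 1 < r) : (annulus 1 r).Nonempty := by
  obtain ⟨s, h1, h2⟩ := exists_between hr
  refine ⟨(s : ℂ), ?_⟩
  simp only [annulus, mem_ofPred_eq, Complex.norm_real, Real.norm_eq_abs,
    abs_of_pos (zero_lt_one.trans h1)]
  exact ⟨h1, h2⟩

/-- A continuous function near the unit circle clustering only at a finite set has a limit. -/
lemma exists_tendsto_outerNhds {ι : Type*} [Finite ι] {g : ℂ → ℝ} {c : ι → ℝ} {R : ℝ}
    (hR : 1 < R) (hg : ContinuousOn g (annulus 1 R))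
    (h : ∀ ε > 0, ∀ᶠ ζ in outerNhds, ∃ i, |g ζ - c i| < ε) :
    ∃ c, Tendsto g outerNhds (𝓝 c) := by
  obtain ⟨δ, hδ, hsep⟩ := exists_pos_forall_le_dist c
  obtain ⟨r₀, hr₀, h0⟩ := eventually_outerNhds_iff.1 (h (δ / 2) (by positivity))
  set r := min r₀ R
  have hr : 1 < r := lt_min hr₀ hR
  obtain ⟨ζ₀, hζ₀⟩ := annulus_nonempty hr
  have hsub : annulus 1 r ⊆ annulus 1 r₀ := fun ζ hζ => ⟨hζ.1, hζ.2.trans_le (min_le_left _ _)⟩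
  have hsub' : annulus 1 r ⊆ annulus 1 R := fun ζ hζ => ⟨hζ.1, hζ.2.trans_le (min_le_right _ _)⟩
  obtain ⟨i₀, hi₀⟩ := h0 ζ₀ (hsub hζ₀)
  have key : g '' annulus 1 r ⊆ ball (c i₀) (δ / 2) := by
    refine ((isPreconnected_annulus zero_le_one).image _ (hg.mono hsub')).subset_left_of_subset_union
      isOpen_ball (v := ⋃ i ∈ {i | c i ≠ c i₀}, ball (c i) (δ / 2))
      (isOpen_biUnion fun _ _ => isOpen_ball) ?_ ?_ ⟨g ζ₀, mem_image_of_mem _ hζ₀, hi₀⟩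
    · rw [disjoint_iUnion₂_right]
      intro i hi
      refine ball_disjoint_ball ?_
      rw [Real.dist_eq, abs_sub_comm]
      linarith [hsep i i₀ hi]
    · rintro _ ⟨ζ, hζ, rfl⟩
      obtain ⟨i, hi⟩ := h0 ζ (hsub hζ)
      by_cases hc : c i = c i₀
      · exact Or.inl (hc ▸ hi)
      · exact Or.inr (mem_biUnion (show i ∈ {i | c i ≠ c i₀} from hc) hi)
  refine ⟨c i₀, Metric.tendsto_nhds.2 fun ε hε => ?_⟩
  have hr' : ∀ᶠ ζ in outerNhds, ζ ∈ annulus 1 r := eventually_outerNhds_iff.2 ⟨r, hr, fun _ h => h⟩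
  filter_upwards [h (min ε (δ / 2)) (by positivity), hr'] with ζ h1 h2
  obtain ⟨i, hi⟩ := h1
  have h3 := key (mem_image_of_mem _ h2)
  rw [mem_ball, Real.dist_eq] at h3
  rw [Real.dist_eq]
  have : c i = c i₀ := by
    by_contra hne
    have := hsep i i₀ hne
    have h4 := abs_sub_le (c i) (g ζ) (c i₀)
    rw [abs_sub_comm (c i) (g ζ)] at h4
    linarith [hi.trans_le (min_le_right _ _)]
  rw [← this]
  exact hi.trans_le (min_le_left _ _)

lemma nhds_le_map_of_injOn {f : ℂ → ℂ} {D : Set ℂ} (hD : IsOpen D) (hf : DifferentiableOn ℂ f D)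
    (hinj : InjOn f D) {a : ℂ} (ha : a ∈ D) : 𝓝 (f a) ≤ map f (𝓝 a) := by
  refine (AnalyticAt.eventually_constant_or_nhds_le_map_nhds
    (hf.analyticAt (hD.mem_nhds ha))).resolve_left fun h => ?_
  obtain ⟨ε, hε, hball⟩ := Metric.eventually_nhds_iff_ball.1 (h.and (hD.mem_nhds ha))
  have hx : a + (ε / 2 : ℝ) ∈ ball a ε := by
    rw [mem_ball, dist_eq_norm, add_sub_cancel_left, Complex.norm_real, Real.norm_eq_abs,
      abs_of_pos (by positivity)]
    linarith
  have := hinj (hball _ hx).2 ha (hball _ hx).1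
  rw [add_eq_left, Complex.ofReal_eq_zero] at this
  linarith

/-- A hydrodynamically normalised univalent map between parallel slit half-planes whose image
omits an `ℍ`-hull has constant imaginary part on each slit. -/
theorem exists_tendsto_im_slit {N N' : ℕ} {w : Fin N → ℂ} {b : Fin N → ℝ} {w' : Fin N' → ℂ}
    {b' : Fin N' → ℝ} (h : IsSlitFamily w b) {f : ℂ → ℂ}
    (hmaps : MapsTo f (slitDomain w b) (slitDomain w' b'))
    (hf : DifferentiableOn ℂ f (slitDomain w b)) (hinj : InjOn f (slitDomain w b))
    (hhull : IsHHull (slitDomain w' b' \ f '' slitDomain w b))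
    (h1 : SatisfiesH1 (slitDomain w b) f) (j : Fin N) :
    ∃ c, Tendsto (fun ζ => (f (slitMap (w j) (b j) ζ)).im) outerNhds (𝓝 c) := by
  obtain ⟨R, hRU, hR⟩ := ((h.eventually_slitEllipse_subset_except j).and self_mem_nhdsWithin).exists
  have hR : 1 < R := hR
  have hDU := slitDomainExcept_diff w b j
  obtain ⟨z, hz, hz', hfz⟩ := h1.exists_seq
  have hb := h.pos j
  have hDo := h.isOpen_slitDomain
  have hmapsG : MapsTo f (slitDomain w b) (UHP \ (slitDomain w' b' \ f '' slitDomain w b)) :=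
    fun x hx => ⟨(hmaps hx).1, fun h' => h'.2 (mem_image_of_mem _ hx)⟩
  have hUp : IsPreconnected (slitDomainExcept w b j) := h.isPreconnected_HP_diff h.im_pos _
  have hUo : IsOpen (slitDomainExcept w b j) := h.isOpen_HP_diff 0 _
  have hFd : DifferentiableOn ℂ (f ∘ slitMap (w j) (b j)) (annulus 1 R) :=
    differentiableOn_comp_slitMap hb hRU (hDU ▸ hf)
  obtain ⟨ρ, hρ1, hρR⟩ := exists_between hR
  obtain ⟨M, hM⟩ := exists_norm_le_annulus hUp hUo hb hRU (hDU ▸ hf) (hDU ▸ hinj) (hDU ▸ hz)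
    hz' hfz hρ1 hρR
  have hfar := fun p (hp : p ∉ UHP \ (slitDomain w' b' \ f '' slitDomain w b)) =>
    exists_le_norm_sub_annulus hUp hUo hb hRU (hDU ▸ hf) (hDU ▸ hinj) (hDU ▸ hz)
    hz' hfz hρ1 hρR hhull.isOpen hhull.2.2.2 (hDU ▸ hmapsG) hp
  refine exists_tendsto_outerNhds (c := fun i => (w' i).im) hR
    (continuous_im.comp_continuousOn hFd.continuousOn) fun ε hε => ?_
  rw [eventually_outerNhds_iff]
  by_contra! hcon
  obtain ⟨r, -, hr, hrlim⟩ := exists_seq_strictAnti_tendsto' (show (1 : ℝ) < ρ from hρ1)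
  choose ζ hζ hζε using fun n => hcon (r n) (hr n).1
  have hζρ : ∀ n, ζ n ∈ annulus 1 ρ := fun n => ⟨(hζ n).1, (hζ n).2.trans (hr n).2⟩
  obtain ⟨p, -, φ, hφ, hlim⟩ := tendsto_subseq_of_bounded
    (x := fun n => f (slitMap (w j) (b j) (ζ n))) (isBounded_closedBall (x := (0 : ℂ)) (r := M))
    (fun n => mem_closedBall_zero_iff.2 (hM _ (hζρ n)))
  have hpε : ∀ i, ε ≤ |p.im - (w' i).im| := fun i =>
    ge_of_tendsto ((((continuous_im.tendsto p).comp hlim).sub_const _).abs)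
      (Eventually.of_forall fun n => hζε (φ n) i)
  have hpG : p ∈ UHP \ (slitDomain w' b' \ f '' slitDomain w b) := by
    by_contra hp
    obtain ⟨δ, hδ, hd⟩ := hfar p hp
    obtain ⟨n, hn⟩ := (hlim.eventually (ball_mem_nhds p hδ)).exists
    rw [dist_eq_norm] at hn
    exact hn.not_ge (hd _ (hζρ _))
  have hpD : p ∈ slitDomain w' b' := by
    refine ⟨hpG.1, fun h' => ?_⟩
    obtain ⟨i, hi⟩ := mem_iUnion.1 h'
    have := hpε i
    rw [hi.1, sub_self, abs_zero] at this
    linarith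
  obtain ⟨a, ha, rfl⟩ : p ∈ f '' slitDomain w b := by
    by_contra h'
    exact hpG.2 ⟨hpD, h'⟩
  have haS : a ∉ slitSeg (w j) (b j) := 
    fun h' => ha.2 (mem_iUnion.2 ⟨j, h'⟩)
  obtain ⟨r₁, hr₁, hr₁'⟩ := ((eventually_notMem_slitEllipse hb haS).and self_mem_nhdsWithin).exists
  have hr₁' : 1 < r₁ := hr₁'
  set Nb := slitDomain w b ∩ (slitEllipse (w j) (b j) r₁)ᶜ
  have hNb : Nb ∈ 𝓝 a := (hDo.inter (isClosed_slitEllipse _ _ _).isOpen_compl).mem_nhds ⟨ha, hr₁⟩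
  have hmem : f '' Nb ∈ 𝓝 (f a) := nhds_le_map_of_injOn hDo hf hinj ha (image_mem_map hNb)
  have hsmall : ∀ᶠ n in atTop, r (φ n) < r₁ :=
    (hrlim.comp hφ.tendsto_atTop).eventually (gt_mem_nhds hr₁')
  obtain ⟨n, hn, hn'⟩ := ((hlim.eventually hmem).and hsmall).exists
  obtain ⟨x, hx, hxe⟩ := hn
  have hsl : slitMap (w j) (b j) (ζ (φ n)) ∈ slitDomain w b := hDU ▸
    mapsTo_slitMap_annulus hb hRU ⟨(hζρ (φ n)).1, (hζρ (φ n)).2.trans hρR⟩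
  have hxeq := hinj hx.1 hsl hxe
  refine hx.2 (hxeq ▸ (slitMap_mem_slitEllipse_iff hb hr₁'.le (hζρ _).1).2 ?_)
  exact ((hζ (φ n)).2.trans hn').le

lemma circleAverage_eq_of_annulus {H : ℂ → ℂ} {R r ρ : ℝ} (hH : DifferentiableOn ℂ H (annulus 1 R))
    (hr : 1 < r) (hrρ : r ≤ ρ) (hρ : ρ < R) :
    Real.circleAverage H 0 ρ = Real.circleAverage H 0 r := by
  rw [Real.circleAverage_eq_circleIntegral (by linarith),
    Real.circleAverage_eq_circleIntegral (by linarith)]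
  congr 1
  simp only [sub_zero, smul_eq_mul]
  refine circleIntegral_eq_of_annulus (R := R) (a := 1) ?_ (by linarith) hr hrρ hρ
  exact (differentiableOn_id.inv fun ζ hζ => ne_zero_of_mem_annulus zero_le_one hζ).mul hH

lemma circleIntegrable_of_annulus {E : Type*} [NormedAddCommGroup E] {H : ℂ → E} {R r : ℝ}
    (hH : ContinuousOn H (annulus 1 R)) (hr : 1 < r) (hρ : r < R) : CircleIntegrable H 0 r :=
  ContinuousOn.circleIntegrable (by linarith) (hH.mono (sphere_subset_annulus hr hρ))

lemma circleAverage_re_eq_of_annulus {H : ℂ → ℂ} {R r ρ : ℝ}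
    (hH : DifferentiableOn ℂ H (annulus 1 R)) (hr : 1 < r) (hrρ : r ≤ ρ) (hρ : ρ < R) :
    Real.circleAverage (fun ζ => (H ζ).re) 0 ρ = Real.circleAverage (fun ζ => (H ζ).re) 0 r := by
  have h1 := reCLM.circleAverage_comp_comm
    (circleIntegrable_of_annulus hH.continuousOn (hr.trans_le hrρ) hρ)
  have h2 := reCLM.circleAverage_comp_comm
    (circleIntegrable_of_annulus hH.continuousOn hr (hrρ.trans_lt hρ))
  rw [circleAverage_eq_of_annulus hH hr hrρ hρ, ← h2] at h1
  exact h1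

lemma closure_annulus_subset {r ρ : ℝ} : closure (annulus r ρ) ⊆ {ζ | r ≤ ‖ζ‖ ∧ ‖ζ‖ ≤ ρ} := by
  refine closure_minimal (fun ζ hζ => ⟨hζ.1.le, hζ.2.le⟩) ?_
  exact (isClosed_le continuous_const continuous_norm).inter
    (isClosed_le continuous_norm continuous_const)

lemma frontier_annulus_subset {r ρ : ℝ} : frontier (annulus r ρ) ⊆ {ζ | ‖ζ‖ = r ∨ ‖ζ‖ = ρ} := by
  intro ζ hζ
  rw [(isOpen_annulus r ρ).frontier_eq] at hζ
  have h1 := closure_annulus_subset hζ.1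
  by_contra h
  rw [mem_ofPred_eq, not_or] at h
  exact hζ.2 ⟨lt_of_le_of_ne h1.1 (Ne.symm h.1), lt_of_le_of_ne h1.2 h.2⟩

lemma re_le_of_annulus {W : ℂ → ℂ} {R r ρ M : ℝ} (hW : DifferentiableOn ℂ W (annulus 1 R))
    (hr : 1 < r) (hρ : ρ < R) (h1 : ∀ ζ : ℂ, ‖ζ‖ = r → (W ζ).re ≤ M)
    (h2 : ∀ ζ : ℂ, ‖ζ‖ = ρ → (W ζ).re ≤ M) : ∀ ζ ∈ annulus r ρ, (W ζ).re ≤ M := by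
  intro ζ hζ
  have hsub : closure (annulus r ρ) ⊆ annulus 1 R := fun z hz =>
    ⟨hr.trans_le (closure_annulus_subset hz).1, (closure_annulus_subset hz).2.trans_lt hρ⟩
  have hb : IsBounded (annulus r ρ) := (isBounded_closedBall (x := (0 : ℂ)) (r := ρ)).subset
    fun z hz => mem_closedBall_zero_iff.2 hz.2.le
  have := Complex.norm_le_of_forall_mem_frontier_norm_le hb (f := fun z => exp (W z))
    (C := Real.exp M) (hW.cexp.mono hsub).diffContOnCl (fun z hz => by
      rw [norm_exp, Real.exp_le_exp]
      exact (frontier_annulus_subset hz).elim (h1 z) (h2 z)) (subset_closure hζ)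
  rwa [norm_exp, Real.exp_le_exp] at this

/-- If `Im W` has a constant boundary value on the unit circle, then it satisfies the maximum
principle on the annulus. -/
lemma im_le_of_tendsto_im {W : ℂ → ℂ} {R ρ c M : ℝ} (hW : DifferentiableOn ℂ W (annulus 1 R))
    (hc : Tendsto (fun ζ => (W ζ).im) outerNhds (𝓝 c)) (hρ1 : 1 < ρ) (hρ : ρ < R)
    (hM : ∀ ζ : ℂ, ‖ζ‖ = ρ → (W ζ).im ≤ M) : ∀ ζ ∈ annulus 1 ρ, (W ζ).im ≤ M := by
  have hV : DifferentiableOn ℂ (fun ζ => -I * W ζ) (annulus 1 R) := hW.const_mul _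
  have hre : ∀ ζ, (-I * W ζ).re = (W ζ).im := fun ζ => by simp
  have hI : ∀ t, 1 < t → t < R → CircleIntegrable (fun ζ => (W ζ).im) 0 t := fun t h1 h2 =>
    circleIntegrable_of_annulus (continuous_im.comp_continuousOn hW.continuousOn) h1 h2
  have hcM : c ≤ M := by
    refine le_of_forall_pos_le_add fun ε hε => ?_
    obtain ⟨r', hr', h⟩ := eventually_outerNhds_iff.1 (hc.eventually (lt_mem_nhds (sub_lt_self c hε)))
    obtain ⟨r, h1, h2⟩ := exists_between (lt_min hr' hρ1)
    have h3 := circleAverage_re_eq_of_annulus hV h1 (h2.le.trans (min_le_right _ _)) hρ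
    simp only [hre] at h3
    have h4 := Real.circleAverage_mono_on_of_le_circle (hI ρ hρ1 hρ) (a := M) fun ζ hζ =>
      hM ζ (by simpa [abs_of_pos (zero_lt_one.trans hρ1)] using hζ)
    have h5 : c - ε ≤ Real.circleAverage (fun ζ => (W ζ).im) 0 r := by
      rw [← Real.circleAverage_const (c - ε) 0 r]
      refine Real.circleAverage_mono (circleIntegrable_const _ _ _)
        (hI r h1 (h2.trans ((min_le_right _ _).trans_lt hρ))) fun ζ hζ => (h ζ ?_).le
      have : ‖ζ‖ = r := by simpa [abs_of_pos (zero_lt_one.trans h1)] using hζ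
      exact ⟨by rwa [this], by rw [this]; exact h2.trans_le (min_le_left _ _)⟩
    linarith
  intro ζ₀ hζ₀
  refine le_of_forall_pos_le_add fun ε hε => ?_
  obtain ⟨r', hr', h⟩ := eventually_outerNhds_iff.1 (hc.eventually (gt_mem_nhds (lt_add_of_pos_right c hε)))
  obtain ⟨r, h1, h2⟩ := exists_between (lt_min hr' hζ₀.1)
  have := re_le_of_annulus hV h1 hρ (M := M + ε) (fun ζ hζ => ?_) (fun ζ hζ => ?_) ζ₀
    ⟨h2.trans_le (min_le_right _ _), hζ₀.2⟩
  · rwa [hre] at this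
  · rw [hre]
    have := h ζ ⟨by rwa [hζ], by rw [hζ]; exact h2.trans_le (min_le_left _ _)⟩
    linarith
  · rw [hre]
    linarith [hM ζ hζ]

lemma two_pi_I_mul_eq_of_annulus {H : ℂ → ℂ} {R r ρ : ℝ} (hH : DifferentiableOn ℂ H (annulus 1 R))
    (hr : 1 < r) (hρ : ρ < R) {ζ₀ : ℂ} (h1 : r < ‖ζ₀‖) (h2 : ‖ζ₀‖ < ρ) :
    2 * Real.pi * I * H ζ₀ =
      (∮ ζ in C(0, ρ), H ζ / (ζ - ζ₀)) - ∮ ζ in C(0, r), H ζ / (ζ - ζ₀) := by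
  have hopen := isOpen_annulus 1 R
  have hζ₀ : ζ₀ ∈ annulus 1 R := ⟨hr.trans h1, h2.trans hρ⟩
  have hS : DifferentiableOn ℂ (dslope H ζ₀) (annulus 1 R) :=
    (Complex.differentiableOn_dslope (hopen.mem_nhds hζ₀)).2 hH
  have hdec : ∀ t, 1 < t → t < R → t ≠ ‖ζ₀‖ → (∮ ζ in C(0, t), H ζ / (ζ - ζ₀)) =
      H ζ₀ * (∮ ζ in C(0, t), (ζ - ζ₀)⁻¹) + ∮ ζ in C(0, t), dslope H ζ₀ ζ := by
    intro t ht1 htR htα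
    have hs := sphere_subset_annulus ht1 htR
    have hne : ∀ ζ ∈ sphere (0 : ℂ) t, ζ - ζ₀ ≠ 0 := fun ζ hζ e => htα (by
      rw [mem_sphere_zero_iff_norm] at hζ
      rw [← hζ, sub_eq_zero.1 e])
    rw [← circleIntegral.integral_const_mul, ← circleIntegral.integral_add]
    · refine circleIntegral.integral_congr (by linarith) fun ζ hζ => ?_
      have hζα := hne ζ hζ
      simp only [dslope_of_ne _ (sub_ne_zero.1 hζα), slope_def_field]
      field_simp
      ring
    · refine ContinuousOn.circleIntegrable (by linarith) (continuousOn_const.mul ?_)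
      exact (continuousOn_id.sub continuousOn_const).inv₀ hne
    · exact ContinuousOn.circleIntegrable (by linarith) (hS.continuousOn.mono hs)
  have e4 : ∮ ζ in C(0, r), (ζ - ζ₀)⁻¹ = 0 := by
    refine Complex.circleIntegral_eq_zero_of_differentiable_on_off_countable (by linarith)
      countable_empty ?_ ?_
    · refine (continuousOn_id.sub continuousOn_const).inv₀ fun ζ hζ e => ?_
      rw [mem_closedBall_zero_iff, show ζ = ζ₀ from sub_eq_zero.1 e] at hζ
      linarith
    · intro ζ hζ
      refine (differentiableAt_id.sub_const ζ₀).inv fun e => ?_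
      have := hζ.1
      rw [mem_ball_zero_iff, show ζ = ζ₀ from sub_eq_zero.1 e] at this
      linarith
  have e5 : ∮ ζ in C(0, ρ), (ζ - ζ₀)⁻¹ = 2 * Real.pi * I :=
    circleIntegral.integral_sub_inv_of_mem_ball (by simpa using h2)
  rw [hdec r hr (by linarith) h1.ne, hdec ρ (by linarith) hρ h2.ne', e4, e5,
    circleIntegral_eq_of_annulus hS (by linarith) hr (h1.trans h2).le hρ]
  ring

/-- If `Im W` has a constant boundary value on the unit circle, then `Re W` satisfies the maximum
principle on the annulus. -/
lemma re_le_of_tendsto_im {W : ℂ → ℂ} {R ρ c M : ℝ} (hW : DifferentiableOn ℂ W (annulus 1 R))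
    (hc : Tendsto (fun ζ => (W ζ).im) outerNhds (𝓝 c)) (hρ1 : 1 < ρ) (hρ : ρ < R)
    (hM : ∀ ζ : ℂ, ‖ζ‖ = ρ → (W ζ).re ≤ M) : ∀ ζ ∈ annulus 1 ρ, (W ζ).re ≤ M := by
  intro ζ₀ hζ₀
  set d := (‖ζ₀‖ - 1) / 2 with hd
  have hd0 : 0 < d := by have := hζ₀.1; simp only [hd]; linarith
  have hρ0 : 0 < ρ - ‖ζ₀‖ := by linarith [hζ₀.2]
  set C := ρ / (ρ - ‖ζ₀‖) + 2 * ρ / d with hC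
  have key : ∀ k : ℝ, 0 < k → Real.exp (k * (W ζ₀).re) ≤ C * Real.exp (k * M) := by
    intro k hk
    set H : ℂ → ℂ := fun ζ => exp (k * (W ζ - c * I))
    have hH : DifferentiableOn ℂ H (annulus 1 R) :=
      ((hW.sub_const _).const_mul _).cexp
    have hHn : ∀ ζ, ‖H ζ‖ = Real.exp (k * (W ζ).re) := fun ζ => by simp [H, norm_exp]
    have hHre : ∀ ζ, (H ζ).re = Real.exp (k * (W ζ).re) * Real.cos (k * ((W ζ).im - c)) :=
      fun ζ => by simp [H, exp_re]
    obtain ⟨r', hr', h⟩ := eventually_outerNhds_iff.1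
      (hc.eventually (ball_mem_nhds c (show 0 < 1 / k by positivity)))
    obtain ⟨r, h1, h2⟩ := exists_between (lt_min hr' (show 1 < 1 + d by linarith))
    have hrd : r < 1 + d := h2.trans_le (min_le_right _ _)
    have hrζ : r < ‖ζ₀‖ - d := by simp only [hd] at hrd ⊢; linarith
    have hr0 : 0 < r := by linarith
    have hrρ : r < ρ := by linarith [hζ₀.2]
    have hHr : ∀ ζ : ℂ, ‖ζ‖ = r → ‖H ζ‖ ≤ 2 * (H ζ).re := by
      intro ζ hζ
      have h3 : |(W ζ).im - c| < 1 / k :=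
        h ζ ⟨by rwa [hζ], by rw [hζ]; exact h2.trans_le (min_le_left _ _)⟩
      have h4 : (k * ((W ζ).im - c)) ^ 2 ≤ 1 := by
        rw [sq_le_one_iff_abs_le_one, abs_mul, abs_of_pos hk]
        rw [lt_div_iff₀' hk] at h3
        exact h3.le
      have h5 := Real.one_sub_sq_div_two_le_cos (x := k * ((W ζ).im - c))
      rw [hHn, hHre]
      nlinarith [Real.exp_pos (k * (W ζ).re)]
    have hIre : ∀ t, 1 < t → t < R → CircleIntegrable (fun ζ => (H ζ).re) 0 t := fun t h1 h2 =>
      circleIntegrable_of_annulus (continuous_re.comp_continuousOn hH.continuousOn) h1 h2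
    have hav : Real.circleAverage (fun ζ => (H ζ).re) 0 r ≤ Real.exp (k * M) := by
      rw [← circleAverage_re_eq_of_annulus hH h1 hrρ.le hρ]
      refine Real.circleAverage_mono_on_of_le_circle (hIre ρ hρ1 hρ) fun ζ hζ => ?_
      have hζ' : ‖ζ‖ = ρ := by simpa [abs_of_pos (zero_lt_one.trans hρ1)] using hζ
      refine (re_le_norm _).trans ?_
      rw [hHn, Real.exp_le_exp]
      exact mul_le_mul_of_nonneg_left (hM ζ hζ') hk.le
    have hI1 : ‖∮ ζ in C(0, ρ), H ζ / (ζ - ζ₀)‖ ≤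
        2 * Real.pi * ρ * (Real.exp (k * M) / (ρ - ‖ζ₀‖)) := by
      refine circleIntegral.norm_integral_le_of_norm_le_const (by linarith) fun ζ hζ => ?_
      rw [mem_sphere_zero_iff_norm] at hζ
      rw [norm_div, hHn]
      have := norm_sub_norm_le ζ ζ₀
      rw [hζ] at this
      gcongr
      exact hM ζ hζ
    have hI2 : ‖∮ ζ in C(0, r), H ζ / (ζ - ζ₀)‖ ≤ 2 * Real.pi * (r * (2 / d)) * Real.exp (k * M) := by
      have hg : ∀ θ : ℝ, ‖deriv (circleMap 0 r) θ • (H (circleMap 0 r θ) / (circleMap 0 r θ - ζ₀))‖ ≤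
          r * (2 / d) * (H (circleMap 0 r θ)).re := by
        intro θ
        have hn : ‖circleMap 0 r θ‖ = r := by simp [abs_of_pos hr0]
        have h3 := hHr _ hn
        have h4 := norm_sub_norm_le ζ₀ (circleMap 0 r θ)
        rw [hn, norm_sub_rev] at h4
        have h5 : d ≤ ‖circleMap 0 r θ - ζ₀‖ := by linarith
        rw [deriv_circleMap, norm_smul, norm_mul, hn, norm_I, mul_one, norm_div, mul_assoc,
          div_mul_eq_mul_div]
        exact mul_le_mul_of_nonneg_left (div_le_div₀ ((norm_nonneg _).trans h3) h3 hd0 h5) hr0.le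
      rw [circleIntegral]
      refine (intervalIntegral.norm_integral_le_of_norm_le Real.two_pi_pos.le
        (Eventually.of_forall fun θ _ => hg θ)
        ((hIre r h1 (hrρ.trans hρ)).const_mul _)).trans ?_
      rw [intervalIntegral.integral_const_mul]
      rw [Real.circleAverage_def, smul_eq_mul, inv_mul_le_iff₀ Real.two_pi_pos] at hav
      calc _ ≤ r * (2 / d) * (2 * Real.pi * Real.exp (k * M)) := by gcongr
        _ = _ := by ring
    have hcau := two_pi_I_mul_eq_of_annulus hH h1 hρ (by linarith) hζ₀.2
    have hn : 2 * Real.pi * Real.exp (k * (W ζ₀).re) ≤ 2 * Real.pi * ρ * (Real.exp (k * M) / (ρ - ‖ζ₀‖))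
        + 2 * Real.pi * (r * (2 / d)) * Real.exp (k * M) := by
      have := norm_sub_le (∮ ζ in C(0, ρ), H ζ / (ζ - ζ₀)) (∮ ζ in C(0, r), H ζ / (ζ - ζ₀))
      rw [← hcau] at this
      have e : ‖2 * Real.pi * I * H ζ₀‖ = 2 * Real.pi * Real.exp (k * (W ζ₀).re) := by
        rw [norm_mul, hHn]
        simp [abs_of_pos Real.pi_pos]
      rw [e] at this
      linarith
    have hn' : Real.exp (k * (W ζ₀).re) ≤ (ρ / (ρ - ‖ζ₀‖) + 2 * r / d) * Real.exp (k * M) := by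
      refine le_of_mul_le_mul_left (hn.trans_eq ?_) Real.two_pi_pos
      ring
    refine hn'.trans ?_
    rw [hC]
    gcongr
  by_contra! hcon
  set t := (W ζ₀).re - M with ht
  have ht0 : 0 < t := by simp only [ht]; linarith
  have hC0 : 0 < C := by
    have := hζ₀.1
    have : 0 < ρ := by linarith
    positivity
  have h1 := key (C / t) (by positivity)
  have h2 : C / t * (W ζ₀).re = C / t * M + C := by
    simp only [ht]
    have : (W ζ₀).re - M ≠ 0 := ht0.ne'
    field_simp
    ring
  rw [h2, Real.exp_add, mul_comm] at h1
  have h3 := le_of_mul_le_mul_right h1 (Real.exp_pos _)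
  linarith [Real.add_one_le_exp C]

/-- `Re W` satisfies the maximum principle on small elliptic regions around the slit
`slitSeg w b`. -/
def SlitMaxPrinciple (w : ℂ) (b : ℝ) (W : ℂ → ℂ) : Prop :=
  ∀ᶠ ρ in 𝓝[>] (1 : ℝ), ∀ M : ℝ, (∀ ζ : ℂ, ‖ζ‖ = ρ → (W (slitMap w b ζ)).re ≤ M) →
    ∀ ζ ∈ annulus 1 ρ, (W (slitMap w b ζ)).re ≤ M

section

variable {N : ℕ} {w : Fin N → ℂ} {b : Fin N → ℝ} {W : ℂ → ℂ}

lemma IsSlitFamily.slitMaxPrinciple_of_re (h : IsSlitFamily w b)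
    (hW : DifferentiableOn ℂ W (slitDomain w b)) {j : Fin N} {c : ℝ}
    (hc : Tendsto (fun ζ => (W (slitMap (w j) (b j) ζ)).im) outerNhds (𝓝 c)) :
    SlitMaxPrinciple (w j) (b j) W := by
  obtain ⟨R, hRU, hR⟩ := ((h.eventually_slitEllipse_subset_except j).and self_mem_nhdsWithin).exists
  have hF := differentiableOn_comp_slitMap (h.pos j) hRU (slitDomainExcept_diff w b j ▸ hW)
  filter_upwards [Ioo_mem_nhdsGT hR] with ρ hρ M hM
  exact re_le_of_tendsto_im hF hc hρ.1 hρ.2 hM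

lemma IsSlitFamily.slitMaxPrinciple_of_im (h : IsSlitFamily w b)
    (hW : DifferentiableOn ℂ W (slitDomain w b)) {j : Fin N} {c : ℝ}
    (hc : Tendsto (fun ζ => (W (slitMap (w j) (b j) ζ)).im) outerNhds (𝓝 c)) :
    SlitMaxPrinciple (w j) (b j) (fun z => -I * W z) := by
  obtain ⟨R, hRU, hR⟩ := ((h.eventually_slitEllipse_subset_except j).and self_mem_nhdsWithin).exists
  have hF := differentiableOn_comp_slitMap (h.pos j) hRU (slitDomainExcept_diff w b j ▸ hW)
  filter_upwards [Ioo_mem_nhdsGT hR] with ρ hρ M hM ζ hζ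
  have := im_le_of_tendsto_im hF hc hρ.1 hρ.2 (M := M) (fun ζ hζ => by simpa using hM ζ hζ) ζ hζ
  simpa using this

lemma notMem_slitSeg_of_im_lt {z w : ℂ} {b : ℝ} (h : w.im < z.im) : z ∉ slitSeg w b :=
  fun h' => h.ne' h'.1

lemma mem_slitDomain_of_im_lt {z : ℂ} (hz : 0 < z.im) (h : ∀ j, (w j).im ≠ z.im) :
    z ∈ slitDomain w b :=
  ⟨hz, fun h' => by
    obtain ⟨j, hj⟩ := mem_iUnion.1 h'
    exact h j hj.1.symm⟩

/-- Maximum principle for `Re W` on the part of a parallel slit half-plane above a line. -/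
theorem IsSlitFamily.re_le (h : IsSlitFamily w b) {a M : ℝ} (ha0 : 0 < a)
    (ha : ∀ j, a < (w j).im) (hW : DifferentiableOn ℂ W (slitDomain w b))
    (hS : ∀ j, SlitMaxPrinciple (w j) (b j) W)
    (hline : ∀ z : ℂ, z.im = a → (W z).re ≤ M)
    (hinf : ∀ ε > 0, ∃ R, ∀ z ∈ slitDomain w b, a ≤ z.im → R < ‖z‖ → (W z).re ≤ M + ε) :
    ∀ z ∈ slitDomain w b, a ≤ z.im → (W z).re ≤ M := by
  intro z₀ hz₀ hz₀a
  by_contra! hcon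
  obtain ⟨R, hR⟩ := hinf (((W z₀).re - M) / 2) (by linarith)
  have e1 : ∀ᶠ ρ in 𝓝[>] (1 : ℝ), ∀ j, z₀ ∉ slitEllipse (w j) (b j) ρ :=
    eventually_all.2 fun j => eventually_notMem_slitEllipse (h.pos j) fun h' =>
      hz₀.2 (mem_iUnion.2 ⟨j, h'⟩)
  have e2 : ∀ᶠ ρ in 𝓝[>] (1 : ℝ), ∀ i j, i ≠ j →
      Disjoint (slitEllipse (w i) (b i) ρ) (slitEllipse (w j) (b j) ρ) := by
    refine eventually_all.2 fun i => eventually_all.2 fun j => ?_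
    by_cases hij : i = j
    · exact Eventually.of_forall fun _ h' => absurd hij h'
    · filter_upwards [eventually_disjoint_slitEllipse (h.pos i) (h.pos j) (h.disj hij)] with ρ h _
      exact h
  have e3 : ∀ᶠ ρ in 𝓝[>] (1 : ℝ), ∀ j, slitEllipse (w j) (b j) ρ ⊆ HP a :=
    eventually_all.2 fun j => eventually_slitEllipse_subset (h.pos j) (isOpen_HP a)
      (slitSeg_subset_HP (ha j))
  obtain ⟨ρ, hSρ, h1, h2, h3, hρ⟩ :=
    ((eventually_all.2 hS).and (e1.and (e2.and (e3.and self_mem_nhdsWithin)))).exists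
  have hρ : 1 < ρ := hρ
  set E : Fin N → Set ℂ := fun j => {z | focalSum (w j) (b j) z < b j * (ρ + ρ⁻¹)}
  have hE : ∀ j, IsOpen (E j) := fun j => isOpen_lt (continuous_focalSum _ _) continuous_const
  have hEs : ∀ j, E j ⊆ slitEllipse (w j) (b j) ρ := fun j z hz => by
    simp only [E, slitEllipse, mem_ofPred_eq] at hz ⊢
    exact hz.le
  have hsegE : ∀ j, slitSeg (w j) (b j) ⊆ E j := fun j z hz => by
    simp only [E, mem_ofPred_eq]
    rw [focalSum_of_mem_slitSeg hz]
    nlinarith [add_inv_lt_add_inv le_rfl hρ, h.pos j]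
  set X : Set ℂ := (closedBall 0 (max R ‖z₀‖) ∩ {z | a ≤ z.im}) \ ⋃ j, E j
  have hXc : IsCompact X :=
    ((isCompact_closedBall _ _).inter_right (isClosed_le continuous_const continuous_im)).diff
      (isOpen_iUnion hE)
  have hXD : X ⊆ slitDomain w b := fun z hz =>
    ⟨ha0.trans_le hz.1.2, fun h' => hz.2 (by
      obtain ⟨j, hj⟩ := mem_iUnion.1 h'
      exact mem_iUnion.2 ⟨j, hsegE j hj⟩)⟩
  have hz₀X : z₀ ∈ X := ⟨⟨mem_closedBall_zero_iff.2 (le_max_right _ _), hz₀a⟩, fun h' => by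
    obtain ⟨j, hj⟩ := mem_iUnion.1 h'
    exact h1 j (hEs j hj)⟩
  obtain ⟨z₁, hz₁, hmax⟩ := hXc.exists_isMaxOn ⟨z₀, hz₀X⟩
    (continuous_re.comp_continuousOn (hW.continuousOn.mono hXD))
  have hz₁z₀ : (W z₀).re ≤ (W z₁).re := hmax hz₀X
  have hfar : ∀ z ∈ slitDomain w b, a ≤ z.im → R < ‖z‖ → (W z).re < (W z₁).re :=
    fun z hz hza hzR => by linarith [hR z hz hza hzR]
  have hout : ∀ z ∈ slitDomain w b, a ≤ z.im → (∀ j, z ∉ E j) → (W z).re ≤ (W z₁).re := by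
    intro z hz hza hzE
    by_cases hzR : ‖z‖ ≤ R
    · exact hmax ⟨⟨mem_closedBall_zero_iff.2 (hzR.trans (le_max_left _ _)), hza⟩, fun h' => by
        obtain ⟨j, hj⟩ := mem_iUnion.1 h'
        exact hzE j hj⟩
    · exact (hfar z hz hza (not_le.1 hzR)).le
  have hall : ∀ z ∈ slitDomain w b, a ≤ z.im → (W z).re ≤ (W z₁).re := by
    intro z hz hza
    by_cases hzE : ∀ j, z ∉ E j
    · exact hout z hz hza hzE
    push Not at hzE
    obtain ⟨j, hj⟩ := hzE
    obtain ⟨ζ, hζ1, rfl⟩ := exists_slitMap_eq (h.pos j) fun h' => hz.2 (mem_iUnion.2 ⟨j, h'⟩)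
    refine hSρ j _ (fun ζ' hζ' => ?_) ζ ⟨hζ1, ?_⟩
    · have hζ'1 : 1 < ‖ζ'‖ := hζ' ▸ hρ
      have hm : slitMap (w j) (b j) ζ' ∈ slitEllipse (w j) (b j) ρ :=
        (slitMap_mem_slitEllipse_iff (h.pos j) hρ.le hζ'1).2 hζ'.le
      have hnE : ∀ i, slitMap (w j) (b j) ζ' ∉ E i := by
        intro i hi
        by_cases hij : i = j
        · subst hij
          simp only [E, mem_ofPred_eq] at hi
          rw [focalSum_slitMap (h.pos i) (norm_pos_iff.1 (zero_lt_one.trans hζ'1)), hζ'] at hi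
          exact lt_irrefl _ hi
        · exact Set.disjoint_left.1 (h2 i j hij) (hEs i hi) hm
      refine hout _ ⟨ha0.trans (h3 j hm), fun h' => ?_⟩ (le_of_lt (h3 j hm)) hnE
      obtain ⟨i, hi⟩ := mem_iUnion.1 h'
      exact hnE i (hsegE i hi)
    · simp only [E, mem_ofPred_eq] at hj
      rw [focalSum_slitMap (h.pos j) (norm_pos_iff.1 (zero_lt_one.trans hζ1)),
        mul_lt_mul_iff_right₀ (h.pos j)] at hj
      exact (add_inv_lt_iff hζ1.le hρ.le).1 hj
  have hz₁a : a < z₁.im := by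
    refine lt_of_le_of_ne hz₁.1.2 fun e => ?_
    linarith [hline z₁ e.symm]
  set Ω := HP a \ ⋃ j ∈ (univ : Set (Fin N)), slitSeg (w j) (b j)
  have hΩD : Ω ⊆ slitDomain w b := fun z hz => ⟨ha0.trans hz.1, by simpa using hz.2⟩
  have hz₁Ω : z₁ ∈ Ω := ⟨hz₁a, by simpa using (hXD hz₁).2⟩
  have hcst := Complex.norm_eqOn_of_isPreconnected_of_isMaxOn (h.isPreconnected_HP_diff ha univ)
    (h.isOpen_HP_diff a univ) (f := fun z => exp (W z)) (hW.cexp.mono hΩD) hz₁Ω fun z hz => by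
      simp only [Function.comp_apply, norm_exp, mem_ofPred_eq, Real.exp_le_exp]
      exact hall z (hΩD hz) (le_of_lt hz.1)
  obtain ⟨y, hy1, hy2, hy3⟩ := ((eventually_gt_atTop (max a R)).and
    ((eventually_all.2 fun j => eventually_gt_atTop (w j).im).and (eventually_gt_atTop 0))).exists
  have him : ((y : ℂ) * I).im = y := by simp
  have hyΩ : (y : ℂ) * I ∈ Ω := by
    refine ⟨by
      show a < ((y : ℂ) * I).im
      rw [him]
      exact (le_max_left _ _).trans_lt hy1, fun h' => ?_⟩
    simp only [mem_iUnion] at h'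
    obtain ⟨j, -, hj⟩ := h'
    exact notMem_slitSeg_of_im_lt (him.symm ▸ hy2 j) hj
  have h4 := hcst hyΩ
  simp only [Function.comp_apply, norm_exp, Function.const_apply, Real.exp_eq_exp] at h4
  refine (hfar _ (hΩD hyΩ) (le_of_lt hyΩ.1) ?_).ne h4
  simpa [abs_of_pos hy3] using (le_max_right _ _).trans_lt hy1

end

lemma eventually_cobounded_inf_iff {S : Set ℂ} {p : ℂ → Prop} :
    (∀ᶠ z in cobounded ℂ ⊓ 𝓟 S, p z) ↔ ∃ R, ∀ z ∈ S, R < ‖z‖ → p z := by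
  rw [eventually_inf_principal, ← comap_norm_atTop,
    (atTop_basis_Ioi.comap (norm : ℂ → ℝ)).eventually_iff]
  simp only [true_and, mem_preimage, mem_Ioi]
  exact ⟨fun ⟨R, hR⟩ => ⟨R, fun z hz h => hR h hz⟩, fun ⟨R, hR⟩ => ⟨R, fun z h hz => hR z hz h⟩⟩

lemma SatisfiesH1.exists_norm_le {D : Set ℂ} {f : ℂ → ℂ} (h : SatisfiesH1 D f) :
    ∃ η₀, 0 ≤ η₀ ∧ ∀ η > η₀, ∀ ε > 0, ∃ R, ∀ z : ℂ, η ≤ z.im → R < ‖z‖ → ‖f z - z‖ ≤ ε := by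
  obtain ⟨η₀, h0, -, hlim⟩ := h
  refine ⟨η₀, h0, fun η hη ε hε => ?_⟩
  obtain ⟨R, hR⟩ := eventually_cobounded_inf_iff.1 (hlim.eventually (closedBall_mem_nhds _ hε))
  exact ⟨R, fun z hz hzR => by simpa using hR z (hη.trans_le hz) hzR⟩

/-- Maximum principle for the real part on a rectangle. -/
lemma re_le_of_rect {W : ℂ → ℂ} {x₁ x₂ y₁ y₂ M : ℝ}
    (hW : DifferentiableOn ℂ W (Icc x₁ x₂ ×ℂ Icc y₁ y₂))
    (hM : ∀ z ∈ Icc x₁ x₂ ×ℂ Icc y₁ y₂, z.re = x₁ ∨ z.re = x₂ ∨ z.im = y₁ ∨ z.im = y₂ →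
      (W z).re ≤ M) :
    ∀ z ∈ Icc x₁ x₂ ×ℂ Icc y₁ y₂, (W z).re ≤ M := by
  intro z hz
  by_cases hbd : z.re = x₁ ∨ z.re = x₂ ∨ z.im = y₁ ∨ z.im = y₂
  · exact hM z hz hbd
  push Not at hbd
  obtain ⟨h1, h2, h3, h4⟩ := hbd
  have hU : z ∈ Ioo x₁ x₂ ×ℂ Ioo y₁ y₂ :=
    ⟨⟨hz.1.1.lt_of_ne' h1, hz.1.2.lt_of_ne h2⟩, hz.2.1.lt_of_ne' h3, hz.2.2.lt_of_ne h4⟩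
  have hx : x₁ < x₂ := hU.1.1.trans hU.1.2
  have hy : y₁ < y₂ := hU.2.1.trans hU.2.2
  have hcl : closure (Ioo x₁ x₂ ×ℂ Ioo y₁ y₂) = Icc x₁ x₂ ×ℂ Icc y₁ y₂ := by
    rw [closure_reProdIm, closure_Ioo hx.ne, closure_Ioo hy.ne]
  have := norm_le_of_forall_mem_frontier_norm_le (f := fun z => exp (W z)) (C := Real.exp M)
    ((isBounded_Ioo x₁ x₂).reProdIm (isBounded_Ioo y₁ y₂))
    (DifferentiableOn.diffContOnCl (hcl ▸ hW.cexp)) (fun ζ hζ => ?_) (subset_closure hU)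
  · simpa [norm_exp] using this
  · rw [norm_exp, Real.exp_le_exp]
    have hζc : ζ ∈ Icc x₁ x₂ ×ℂ Icc y₁ y₂ := hcl ▸ hζ.1
    refine hM ζ hζc ?_
    by_contra! hcon
    refine hζ.2 ?_
    rw [(isOpen_Ioo.reProdIm isOpen_Ioo).interior_eq]
    exact ⟨⟨hζc.1.1.lt_of_ne' hcon.1, hζc.1.2.lt_of_ne hcon.2.1⟩,
      hζc.2.1.lt_of_ne' hcon.2.2.1, hζc.2.2.lt_of_ne hcon.2.2.2⟩

section

variable {N : ℕ} {w : Fin N → ℂ} {b : Fin N → ℝ} {g : ℂ → ℂ}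

lemma exists_far (w : Fin N → ℂ) (b : Fin N → ℝ) :
    ∃ X > 0, ∀ z : ℂ, 0 < z.im → X < |z.re| → z ∈ slitDomain w b := by
  obtain ⟨X, hX0, hX⟩ := ((eventually_gt_atTop (0 : ℝ)).and (eventually_all.2 fun j =>
    eventually_gt_atTop (|(w j).re| + |b j|))).exists
  refine ⟨X, hX0, fun z hz hzX => ⟨hz, fun h' => ?_⟩⟩
  obtain ⟨j, -, h1, h2⟩ := mem_iUnion.1 h'
  have := hX j
  have h3 := abs_le.1 (le_refl |(w j).re|)
  have h4 := le_abs_self (b j)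
  rcases lt_abs.1 hzX with h | h <;> linarith

lemma exists_top (w : Fin N → ℂ) (y : ℝ) : ∃ Y > y, ∀ j, (w j).im < Y :=
  ((eventually_gt_atTop y).and (eventually_all.2 fun j => eventually_gt_atTop (w j).im)).exists

lemma IsSlitFamily.exists_lt_im (h : IsSlitFamily w b) {y : ℝ} (hy : 0 < y) :
    ∃ a > 0, a < y ∧ ∀ j, a < (w j).im := by
  have h1 : ∀ᶠ a in 𝓝[>] (0 : ℝ), a < y ∧ ∀ j, a < (w j).im :=
    ((eventually_lt_nhds hy).and
      (eventually_all.2 fun j => eventually_lt_nhds (h.im_pos j))).filter_mono nhdsWithin_le_nhds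
  obtain ⟨a, h2, h3⟩ := (h1.and self_mem_nhdsWithin).exists
  exact ⟨a, h3, h2⟩

lemma norm_le_abs_re_add_abs_im' (z : ℂ) {R L : ℝ} (h : R + L < ‖z‖) (hL : |z.im| ≤ L) :
    R < |z.re| := by
  have := Complex.norm_le_abs_re_add_abs_im z
  linarith

lemma IsSlitFamily.neg_im_le_of_strip (hgd : DifferentiableOn ℂ g (slitDomain w b))
    (hg : ∀ z ∈ slitDomain w b, 0 ≤ (g z).im + z.im) {η : ℝ} (hη : 0 < η)
    (hinf : ∀ ε > 0, ∃ R, ∀ z : ℂ, η ≤ z.im → R < ‖z‖ → ‖g z‖ ≤ ε) {a : ℝ} (ha : 0 < a)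
    {ε : ℝ} (hε : 0 < ε) :
    ∃ R, ∀ z ∈ slitDomain w b, a ≤ z.im → R < ‖z‖ → -(g z).im ≤ a + ε := by
  obtain ⟨R₁, hR₁⟩ := hinf (ε / 2) (by positivity)
  obtain ⟨X, hX0, hX⟩ := exists_far w b
  set κ : ℝ := ε / (2 * η ^ 2) with hκ
  have hκ0 : 0 < κ := by positivity
  set L : ℝ := Real.sqrt (η / κ)
  have hL0 : 0 < L := Real.sqrt_pos.2 (by positivity)
  have hL : κ * L ^ 2 = η := by
    rw [Real.sq_sqrt (by positivity)]; field_simp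
  refine ⟨max R₁ 0 + X + L + η, fun z hz hza hzR => ?_⟩
  have hm := le_max_left R₁ 0
  have hm' := le_max_right R₁ 0
  by_cases hzη : η ≤ z.im
  · have h1 := (abs_im_le_norm (g z)).trans (hR₁ z hzη (by linarith))
    linarith [neg_abs_le (g z).im]
  push Not at hzη
  have hre := norm_le_abs_re_add_abs_im' z hzR (by rw [abs_of_pos (ha.trans_le hza)]; exact hzη.le)
  have hfar : ∀ ζ ∈ Icc (z.re - L) (z.re + L) ×ℂ Icc a η, max R₁ 0 + X < |ζ.re| := by
    rintro ζ ⟨⟨h1, h2⟩, -⟩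
    rcases lt_abs.1 hre with h | h
    · exact lt_abs.2 (Or.inl (by linarith))
    · exact lt_abs.2 (Or.inr (by linarith))
  have hsub : Icc (z.re - L) (z.re + L) ×ℂ Icc a η ⊆ slitDomain w b := fun ζ hζ =>
    hX ζ (ha.trans_le hζ.2.1) (by linarith [hfar ζ hζ])
  have hre : ∀ ζ : ℂ, ((I * g ζ - κ * ((ζ - z.re) ^ 2 + η ^ 2)) : ℂ).re =
      -(g ζ).im - κ * ((ζ.re - z.re) ^ 2 - ζ.im ^ 2 + η ^ 2) := by
    intro ζ
    have : ((ζ - z.re) ^ 2 + η ^ 2 : ℂ).re = (ζ.re - z.re) ^ 2 - ζ.im ^ 2 + η ^ 2 := by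
      simp only [pow_two, add_re, mul_re, sub_re, sub_im, ofReal_re, ofReal_im]; ring
    rw [sub_re, re_ofReal_mul, this]
    simp
  have key := re_le_of_rect (W := fun ζ => I * g ζ - κ * ((ζ - z.re) ^ 2 + η ^ 2))
    (M := a + ε / 2) (x₁ := z.re - L) (x₂ := z.re + L) (y₁ := a) (y₂ := η)
    (((hgd.mono hsub).const_mul I).sub (by fun_prop)) (fun ζ hζ hb => ?_) z
    ⟨⟨by linarith, by linarith⟩, hza, hzη.le⟩
  · rw [hre] at key
    have h1 : κ * η ^ 2 = ε / 2 := by rw [hκ]; field_simp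
    have h2 : 0 ≤ κ * z.im ^ 2 := by positivity
    nlinarith
  · have h0 := hg ζ (hsub hζ)
    have him0 : 0 < ζ.im := ha.trans_le hζ.2.1
    have him1 : ζ.im ^ 2 ≤ η ^ 2 := pow_le_pow_left₀ him0.le hζ.2.2 2
    rw [hre]
    have h1 : 0 ≤ κ * (η ^ 2 - ζ.im ^ 2) := mul_nonneg hκ0.le (by linarith)
    have h2 : 0 ≤ κ * (ζ.re - z.re) ^ 2 := by positivity
    have hsq : ζ.re = z.re - L ∨ ζ.re = z.re + L → κ * (ζ.re - z.re) ^ 2 = η := by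
      rintro (h | h) <;> rw [h, ← hL] <;> ring
    rcases hb with h | h | h | h
    · linarith [hsq (Or.inl h), hζ.2.2]
    · linarith [hsq (Or.inr h), hζ.2.2]
    · linarith
    · have h3 := (abs_im_le_norm (g ζ)).trans (hR₁ ζ h.ge (by
        linarith [hfar ζ hζ, abs_re_le_norm ζ]))
      linarith [neg_abs_le (g ζ).im]

/-- If `Im (g z) ≥ -Im z`, `Im g` is constant on each slit and `g` vanishes at infinity, then
`Im g ≥ 0`. -/
theorem IsSlitFamily.im_nonneg (h : IsSlitFamily w b) (hgd : DifferentiableOn ℂ g (slitDomain w b))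
    (hg : ∀ z ∈ slitDomain w b, 0 ≤ (g z).im + z.im) {η : ℝ} (hη : 0 < η)
    (hinf : ∀ ε > 0, ∃ R, ∀ z : ℂ, η ≤ z.im → R < ‖z‖ → ‖g z‖ ≤ ε)
    (hc : ∀ j, ∃ c, Tendsto (fun ζ => (g (slitMap (w j) (b j) ζ)).im) outerNhds (𝓝 c)) :
    ∀ z ∈ slitDomain w b, 0 ≤ (g z).im := by
  intro z hz
  by_contra! hcon
  obtain ⟨a, ha0, ha1, ha2⟩ := h.exists_lt_im (lt_min hz.1 (neg_pos.2 hcon))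
  have hre : ∀ ζ, (-I * -g ζ).re = -(g ζ).im := fun ζ => by simp
  have := h.re_le (W := fun ζ => -I * -g ζ) (M := a) ha0 ha2 (hgd.neg.const_mul _)
    (fun j => ?_) (fun ζ hζ => ?_) (fun ε hε => ?_) z hz (ha1.trans_le (min_le_left _ _)).le
  · rw [hre] at this
    exact absurd (ha1.trans_le (min_le_right _ _)) (not_lt.2 this)
  · obtain ⟨c, hc⟩ := hc j
    exact h.slitMaxPrinciple_of_im (W := fun ζ => -g ζ) (c := -c) hgd.neg (by simpa using hc.neg)
  · rw [hre]
    have := hg ζ (mem_slitDomain_of_im_lt (hζ ▸ ha0) fun j => hζ ▸ (ha2 j).ne')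
    linarith
  · simp only [hre]
    exact neg_im_le_of_strip hgd hg hη hinf ha0 hε

end

/-- Gradient bound for a holomorphic function with nonnegative imaginary part. -/
lemma norm_deriv_le_of_im_nonneg {G : ℂ → ℂ} {z : ℂ} {r : ℝ} (hr : 0 < r)
    (hG : DifferentiableOn ℂ G (ball z r)) (him : ∀ ζ ∈ ball z r, 0 ≤ (G ζ).im) :
    ‖deriv G z‖ ≤ 2 / r * (G z).im := by
  have key : ∀ ε > 0, ‖deriv G z‖ ≤ 2 / r * ((G z).im + ε) := by
    intro ε hε
    set q : ℂ := G z + ε * I with hq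
    have hqi : q.im = (G z).im + ε := by simp [hq]
    have hq0 : 0 < q.im := by linarith [him z (mem_ball_self hr)]
    set ψ : ℂ → ℂ := fun ζ => (G ζ + ε * I - q) / (G ζ + ε * I - (starRingEnd ℂ) q) with hψ
    have hden : ∀ ζ ∈ ball z r, G ζ + ε * I - (starRingEnd ℂ) q ≠ 0 := by
      intro ζ hζ h0
      have := congrArg Complex.im h0
      simp only [sub_im, add_im, conj_im, zero_im, im_ofReal_mul, I_im] at this
      linarith [him ζ hζ]
    have hψd : DifferentiableOn ℂ ψ (ball z r) :=
      ((hG.add_const _).sub_const _).div ((hG.add_const _).sub_const _) hden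
    have hψz : ψ z = 0 := by simp [hψ, hq]
    have hmaps : MapsTo ψ (ball z r) (closedBall (ψ z) 1) := by
      intro ζ hζ
      rw [hψz, mem_closedBall_zero_iff, hψ]
      simp only [norm_div]
      refine div_le_one_of_le₀ ?_ (norm_nonneg _)
      have h2 : 0 < (G ζ + ε * I).im := by simpa using by linarith [him ζ hζ]
      rw [← sq_le_sq₀ (norm_nonneg _) (norm_nonneg _), ← normSq_eq_norm_sq, ← normSq_eq_norm_sq,
        normSq_apply, normSq_apply]
      simp only [sub_re, sub_im, conj_re, conj_im]
      nlinarith [mul_pos h2 hq0]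
    have h1 := norm_deriv_le_div_of_mapsTo_ball hψd hmaps hr
    have hGd : HasDerivAt G (deriv G z) z :=
      (hG.differentiableAt (ball_mem_nhds z hr)).hasDerivAt
    have h2 : HasDerivAt ψ (deriv G z / (q - (starRingEnd ℂ) q)) z := by
      have h3 := ((hGd.add_const (ε * I)).sub_const q).fun_div
        ((hGd.add_const (ε * I)).sub_const ((starRingEnd ℂ) q)) (hden z (mem_ball_self hr))
      have h4 := hden z (mem_ball_self hr)
      rw [← hq] at h3 h4
      refine h3.congr_deriv ?_
      rw [sub_self, zero_mul, sub_zero, pow_two, mul_div_mul_right _ _ h4]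
    rw [h2.deriv, norm_div, div_le_div_iff₀ _ hr] at h1
    · rw [sub_conj, norm_mul, norm_I, mul_one, norm_real, Real.norm_of_nonneg (by positivity),
        hqi] at h1
      rw [div_mul_eq_mul_div, le_div_iff₀ hr]
      linarith
    · rw [norm_pos_iff]; exact hq ▸ hden z (mem_ball_self hr)
  refine le_of_forall_pos_le_add fun ε hε => ?_
  have := key (ε * r / 2) (by positivity)
  calc _ ≤ _ := this
    _ = _ := by field_simp

lemma hasDerivAt_comp_vertical {G : ℂ → ℂ} {x y : ℝ} (hG : DifferentiableAt ℂ G (x + y * I)) :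
    HasDerivAt (fun t : ℝ => G (x + t * I)) (deriv G (x + y * I) * I) y := by
  have h1 : HasDerivAt (fun t : ℝ => (x : ℂ) + t * I) I y := by
    simpa using ((hasDerivAt_id y).ofReal_comp.mul_const I).const_add (x : ℂ)
  exact hG.hasDerivAt.comp (𝕜' := ℂ) y h1

lemma HasDerivAt.complex_im {f : ℝ → ℂ} {f' : ℂ} {t : ℝ} (h : HasDerivAt f f' t) :
    HasDerivAt (fun t => (f t).im) f'.im t :=
  imCLM.hasFDerivAt.comp_hasDerivAt t h

/-- Harnack-type comparison on a vertical segment. -/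
lemma norm_le_of_vertical {G : ℂ → ℂ} {x a η : ℝ} (ha : 0 < a)
    (hG : ∀ y ∈ Icc a η, DifferentiableOn ℂ G (ball (x + y * I) y))
    (him : ∀ y ∈ Icc a η, ∀ ζ ∈ ball (x + y * I : ℂ) y, 0 ≤ (G ζ).im) {y : ℝ} (hy : y ∈ Icc a η) :
    ‖G (x + y * I)‖ ≤ (1 + 2 * (η / a) ^ 3) * ‖G (x + η * I)‖ := by
  have hpos : ∀ y ∈ Icc a η, 0 < y := fun y hy => ha.trans_le hy.1
  have haη : a ≤ η := hy.1.trans hy.2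
  have hη : η ∈ Icc a η := ⟨haη, le_rfl⟩
  have hη0 := hpos η hη
  have hder : ∀ y ∈ Icc a η, HasDerivAt (fun t : ℝ => G (x + t * I)) (deriv G (x + y * I) * I) y :=
    fun y hy => hasDerivAt_comp_vertical ((hG y hy).differentiableAt (ball_mem_nhds _ (hpos y hy)))
  have hbd : ∀ y ∈ Icc a η, ‖deriv G (x + y * I)‖ ≤ 2 / y * (G (x + y * I)).im :=
    fun y hy => norm_deriv_le_of_im_nonneg (hpos y hy) (hG y hy) (him y hy)
  have hder2 : ∀ y ∈ Icc a η, HasDerivAt (fun t : ℝ => t ^ 2 * (G (x + t * I)).im)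
      (2 * y * (G (x + y * I)).im + y ^ 2 * (deriv G (x + y * I) * I).im) y := fun y hy => by
    simpa using (hasDerivAt_pow 2 y).fun_mul (hder y hy).complex_im
  have hmono : MonotoneOn (fun t : ℝ => t ^ 2 * (G (x + t * I)).im) (Icc a η) := by
    refine monotoneOn_of_deriv_nonneg (convex_Icc _ _)
      (fun y hy => (hder2 y hy).continuousAt.continuousWithinAt)
      (fun y hy => (hder2 y (interior_subset hy)).differentiableAt.differentiableWithinAt)
      fun y hy => ?_
    have hy := interior_subset hy
    rw [(hder2 y hy).deriv]
    have h1 := abs_im_le_norm (deriv G (x + y * I) * I)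
    rw [norm_mul, norm_I, mul_one] at h1
    have h2 := (neg_abs_le _).trans' (neg_le_neg (h1.trans (hbd y hy)))
    have h3 : y ^ 2 * (2 / y * (G (x + y * I)).im) = 2 * y * (G (x + y * I)).im := by
      have := (hpos y hy).ne'
      field_simp
    nlinarith [mul_le_mul_of_nonneg_left h2 (sq_nonneg y)]
  have hle : ∀ y ∈ Icc a η, (G (x + y * I)).im ≤ (η / a) ^ 2 * ‖G (x + η * I)‖ := by
    intro y hy
    have h1 := hmono hy hη hy.2
    simp only at h1
    have h2 := him y hy _ (mem_ball_self (hpos y hy))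
    have h3 : a ^ 2 ≤ y ^ 2 := pow_le_pow_left₀ ha.le hy.1 2
    rw [div_pow, div_mul_eq_mul_div, le_div_iff₀ (by positivity)]
    have h4 := (le_abs_self _).trans (abs_im_le_norm (G (x + η * I)))
    nlinarith [mul_le_mul_of_nonneg_left h4 (sq_nonneg η), mul_le_mul_of_nonneg_right h3 h2]
  have hmv := (convex_Icc a η).norm_image_sub_le_of_norm_hasDerivWithin_le
    (C := 2 / a * ((η / a) ^ 2 * ‖G (x + η * I)‖))
    (fun y hy => (hder y hy).hasDerivWithinAt) (fun y hy => ?_) hη hy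
  · have h1 : ‖y - η‖ ≤ η := by
      rw [Real.norm_eq_abs, abs_le]; constructor <;> linarith [hy.1, hy.2]
    have h2 := norm_le_norm_add_norm_sub' (G (x + y * I)) (G (x + η * I))
    have h3 := hmv.trans (mul_le_mul_of_nonneg_left h1 (by positivity))
    have h4 : 2 / a * ((η / a) ^ 2 * ‖G (x + η * I)‖) * η =
        2 * (η / a) ^ 3 * ‖G (x + η * I)‖ := by field_simp
    linarith
  · rw [norm_mul, norm_I, mul_one]
    refine (hbd y hy).trans (mul_le_mul (div_le_div_of_nonneg_left (by norm_num) ha hy.1) (hle y hy)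
      (him y hy _ (mem_ball_self (hpos y hy))) (by positivity))

lemma abs_im_lt_of_mem_ball {z ζ : ℂ} {r : ℝ} (h : ζ ∈ ball z r) :
    |ζ.im - z.im| < r ∧ |ζ.re - z.re| < r := by
  rw [mem_ball, dist_eq_norm] at h
  exact ⟨(abs_im_le_norm (ζ - z)).trans_lt h, (abs_re_le_norm (ζ - z)).trans_lt h⟩

/-- Decay at infinity on `{Im z ≥ η}` propagates to `{Im z ≥ a}`. -/
lemma tendsto_zero_of_im_nonneg {N : ℕ} {w : Fin N → ℂ} {b : Fin N → ℝ} {G : ℂ → ℂ}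
    (hG : DifferentiableOn ℂ G (slitDomain w b)) (him : ∀ z ∈ slitDomain w b, 0 ≤ (G z).im)
    {η : ℝ} (hinf : ∀ ε > 0, ∃ R, ∀ z : ℂ, η ≤ z.im → R < ‖z‖ → ‖G z‖ ≤ ε)
    {a : ℝ} (ha : 0 < a) {ε : ℝ} (hε : 0 < ε) :
    ∃ R, ∀ z : ℂ, a ≤ z.im → R < ‖z‖ → ‖G z‖ ≤ ε := by
  obtain ⟨R₀, hR₀⟩ := hinf ε hε
  by_cases haη : η ≤ a
  · exact ⟨R₀, fun z hz hzR => hR₀ z (haη.trans hz) hzR⟩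
  push Not at haη
  have hη := ha.trans haη
  obtain ⟨R₁, hR₁⟩ := hinf (ε / (1 + 2 * (η / a) ^ 3)) (by positivity)
  obtain ⟨X, hX0, hX⟩ := exists_far w b
  refine ⟨max R₀ 0 + max R₁ 0 + X + η + η, fun z hz hzR => ?_⟩
  have h0 := le_max_left R₀ 0
  have h0' := le_max_right R₀ 0
  have h1 := le_max_left R₁ 0
  have h1' := le_max_right R₁ 0
  by_cases hzη : η ≤ z.im
  · exact hR₀ z hzη (by linarith)
  push Not at hzη
  have hre := norm_le_abs_re_add_abs_im' z hzR (by rw [abs_of_pos (ha.trans_le hz)]; exact hzη.le)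
  have hball : ∀ y ∈ Icc a η, ball (z.re + y * I : ℂ) y ⊆ slitDomain w b := by
    intro y hy ζ hζ
    obtain ⟨h2, h3⟩ := abs_im_lt_of_mem_ball hζ
    simp only [add_im, ofReal_im, im_ofReal_mul, I_im, add_re, ofReal_re, re_ofReal_mul, I_re] at h2 h3
    rw [abs_lt] at h2 h3
    refine hX ζ (by linarith) ?_
    rcases lt_abs.1 hre with h | h
    · exact lt_abs.2 (Or.inl (by linarith [hy.2]))
    · exact lt_abs.2 (Or.inr (by linarith [hy.2]))
  have h2 := norm_le_of_vertical ha (fun y hy => hG.mono (hball y hy))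
    (fun y hy ζ hζ => him ζ (hball y hy hζ)) ⟨hz, hzη.le⟩
  rw [re_add_im] at h2
  have h3 := hR₁ (z.re + η * I) (by simp) (by
    have := abs_re_le_norm (z.re + η * I : ℂ)
    simp only [add_re, ofReal_re, re_ofReal_mul, I_re, mul_zero, add_zero] at this
    linarith)
  calc _ ≤ _ := h2
    _ ≤ (1 + 2 * (η / a) ^ 3) * (ε / (1 + 2 * (η / a) ^ 3)) := by gcongr
    _ = ε := by field_simp

/-- Part of the Poisson integral of a nonnegative harmonic function over an arc. -/
lemma integral_poissonKernel_mul_im_le {G : ℂ → ℂ} {V : Set ℂ} {c p : ℂ} {R X : ℝ}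
    (hV : IsOpen V) (hG : DifferentiableOn ℂ G V) (hsub : closedBall c R ⊆ V)
    (him : ∀ z ∈ closedBall c R, 0 ≤ (G z).im) (hR : 0 < R) (hp : p ∈ ball c R) (hX : 0 ≤ X)
    (hXR : X ≤ Real.pi * R) :
    ∫ x in -X..X, poissonKernel c p (circleMap c R (-(Real.pi / 2) + R⁻¹ * x)) *
      (G (circleMap c R (-(Real.pi / 2) + R⁻¹ * x))).im ≤ 2 * Real.pi * R * (G p).im := by
  set F : ℝ → ℝ := fun θ => poissonKernel c p (circleMap c R θ) * (G (circleMap c R θ)).im with hF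
  have hmem : ∀ θ, circleMap c R θ ∈ closedBall c R := circleMap_mem_closedBall c hR.le
  have hharm : InnerProductSpace.HarmonicOnNhd (fun z => (G z).im) (closedBall c R) :=
    fun z hz => (hG.analyticAt (hV.mem_nhds (hsub hz))).harmonicAt_im
  have hP := hharm.circleAverage_poissonKernel_smul hp
  rw [Real.circleAverage_def] at hP
  have hper : Function.Periodic F (2 * Real.pi) := fun θ => by
    simp only [hF, periodic_circleMap c R θ]
  have hcont : Continuous F := by
    refine Continuous.mul ?_ ?_
    · simp only [poissonKernel_def]
      refine Continuous.div (by fun_prop) (by fun_prop) fun θ h0 => ?_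
      have h1 : circleMap c R θ = p := by
        rw [pow_eq_zero_iff two_ne_zero, norm_eq_zero] at h0
        linear_combination h0
      have h2 : dist (circleMap c R θ) c = R := circleMap_mem_sphere c hR.le θ
      exact (h1 ▸ hp : circleMap c R θ ∈ ball c R).ne h2
    · exact continuous_im.comp
        (hG.continuousOn.comp_continuous (continuous_circleMap c R) fun θ => hsub (hmem θ))
  have hpos : ∀ θ, 0 ≤ F θ := fun θ => by
    refine mul_nonneg ?_ (him _ (hmem θ))
    rw [poissonKernel_def]
    refine div_nonneg (sub_nonneg.2 (pow_le_pow_left₀ (norm_nonneg _) ?_ 2)) (by positivity)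
    have h2 : dist (circleMap c R θ) c = R := circleMap_mem_sphere c hR.le θ
    rw [← dist_eq_norm, ← dist_eq_norm, h2]
    exact (mem_ball.1 hp).le
  have h1 : ∫ θ in (0 : ℝ)..2 * Real.pi, F θ = 2 * Real.pi * (G p).im := by
    rw [← hP, smul_eq_mul, mul_inv_cancel_left₀ (by positivity)]
    rfl
  have h2 := hper.intervalIntegral_add_eq (-(Real.pi / 2) - Real.pi) 0
  rw [zero_add, h1] at h2
  have hle : R⁻¹ * X ≤ Real.pi := by rw [inv_mul_le_iff₀ hR]; linarith
  have h3 : ∫ θ in -(Real.pi / 2) + R⁻¹ * (-X)..-(Real.pi / 2) + R⁻¹ * X, F θ ≤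
      2 * Real.pi * (G p).im := by
    rw [← h2]
    refine intervalIntegral.integral_mono_interval (by linarith) ?_ (by linarith)
      (Eventually.of_forall hpos) (hcont.intervalIntegrable _ _)
    have : 0 ≤ R⁻¹ * X := by positivity
    linarith
  rw [← intervalIntegral.smul_integral_comp_add_mul, smul_eq_mul, inv_mul_le_iff₀ hR] at h3
  linarith

lemma tendsto_circleMap_bottom (Y x : ℝ) :
    Tendsto (fun t : ℝ => circleMap ((Y + t⁻¹ : ℝ) * I) t⁻¹ (-(Real.pi / 2) + t⁻¹⁻¹ * x)) (𝓝[>] 0)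
      (𝓝 (x + Y * I)) := by
  have h1 : HasDerivAt (fun t : ℝ => exp (t * (x * I))) (x * I) 0 := by
    have := ((hasDerivAt_id (0 : ℝ)).ofReal_comp.mul_const (x * I : ℂ)).cexp
    simpa using this
  have h2 := (hasDerivAt_iff_tendsto_slope_zero.1 h1).mono_left
    (nhdsWithin_mono 0 fun t (ht : 0 < t) => ht.ne')
  have h3 := (h2.const_mul (-I)).const_add (Y * I : ℂ)
  have h4 : (Y * I + -I * (x * I) : ℂ) = x + Y * I := by
    linear_combination (-x : ℂ) * I_sq
  rw [h4] at h3
  refine h3.congr fun t => ?_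
  have h5 : exp (((-(Real.pi / 2) + t⁻¹⁻¹ * x : ℝ) : ℂ) * I) = -I * exp (t * (x * I)) := by
    have : ((-(Real.pi / 2) + t⁻¹⁻¹ * x : ℝ) : ℂ) * I = -Real.pi / 2 * I + t * (x * I) := by
      push_cast; rw [inv_inv]; ring
    rw [this, exp_add, exp_neg_pi_div_two_mul_I]
  rw [circleMap, h5]
  simp only [zero_add, ofReal_zero, zero_mul, exp_zero, real_smul]
  push_cast
  ring

/-- The flux of `Im G` through a horizontal line is controlled by the angular residue. -/
lemma integral_im_le_of_residue {G : ℂ → ℂ} {Y₀ Y B γ X : ℝ} (hY : Y₀ < Y)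
    (hG : DifferentiableOn ℂ G (HP Y₀)) (him : ∀ z ∈ HP Y₀, 0 ≤ (G z).im)
    (hB : ∀ z : ℂ, Y ≤ z.im → ‖G z‖ ≤ B)
    (hγ : Tendsto (fun y : ℝ => y * (G (y * I)).im) atTop (𝓝 γ)) (hX : 0 ≤ X) :
    ∫ x in -X..X, (G (x + Y * I)).im ≤ 8 * Real.pi / 7 * γ := by
  set m : ℝ → ℝ → ℂ := fun t x => circleMap ((Y + t⁻¹ : ℝ) * I) t⁻¹ (-(Real.pi / 2) + t⁻¹⁻¹ * x)
  set P : ℝ → ℝ → ℝ := fun t x =>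
    poissonKernel ((Y + t⁻¹ : ℝ) * I) ((Y + t⁻¹ / 4 : ℝ) * I) (m t x)
  have hP : ∀ t > 0, ∀ x, P t x = (7 / 16) / ‖exp ((t * x : ℝ) * I) - 3 / 4‖ ^ 2 := by
    intro t ht x
    have h5 : exp (((-(Real.pi / 2) + t⁻¹⁻¹ * x : ℝ) : ℂ) * I) = -I * exp ((t * x : ℝ) * I) := by
      have : ((-(Real.pi / 2) + t⁻¹⁻¹ * x : ℝ) : ℂ) * I = -Real.pi / 2 * I + (t * x : ℝ) * I := by
        push_cast; rw [inv_inv]; ring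
      rw [this, exp_add, exp_neg_pi_div_two_mul_I]
    have e1 : m t x - (Y + t⁻¹ : ℝ) * I = (t⁻¹ : ℝ) * (-I * exp ((t * x : ℝ) * I)) := by
      simp only [m, circleMap, h5]; ring
    have e2 : ((Y + t⁻¹ / 4 : ℝ) * I - (Y + t⁻¹ : ℝ) * I : ℂ) = (t⁻¹ : ℝ) * (-I * (3 / 4)) := by
      push_cast; ring
    have ht' : 0 < t⁻¹ := inv_pos.2 ht
    simp only [P, poissonKernel_def]
    rw [e1, e2, ← mul_sub, ← mul_sub]
    simp only [norm_mul, norm_neg, norm_I, one_mul, norm_real, Real.norm_of_nonneg ht'.le,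
      norm_exp_ofReal_mul_I, mul_pow]
    have : ‖(3 / 4 : ℂ)‖ = 3 / 4 := by norm_num
    rw [this, ← mul_sub, mul_div_mul_left _ _ (by positivity)]
    norm_num
  have hden : ∀ s : ℝ, (1 / 4 : ℝ) ≤ ‖exp (s * I) - 3 / 4‖ := fun s => by
    have := norm_sub_norm_le (exp (s * I)) (3 / 4)
    rw [norm_exp_ofReal_mul_I] at this
    norm_num at this ⊢
    linarith
  have hden0 : ∀ s : ℝ, ‖exp (s * I) - 3 / 4‖ ^ 2 ≠ 0 := fun s =>
    (pow_pos (lt_of_lt_of_le (by norm_num) (hden s)) 2).ne'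
  have hmim : ∀ t > 0, ∀ x, Y ≤ (m t x).im := by
    intro t ht x
    have h1 : m t x ∈ closedBall ((Y + t⁻¹ : ℝ) * I : ℂ) t⁻¹ :=
      circleMap_mem_closedBall _ (inv_pos.2 ht).le _
    rw [mem_closedBall, dist_eq_norm] at h1
    have h2 := (neg_abs_le _).trans' (neg_le_neg ((abs_im_le_norm _).trans h1))
    simp only [sub_im, im_ofReal_mul, I_im, mul_one] at h2
    linarith
  have hlim1 : Tendsto (fun t => ∫ x in -X..X, P t x * (G (m t x)).im) (𝓝[>] 0)
      (𝓝 (∫ x in -X..X, 7 * (G (x + Y * I)).im)) := by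
    refine intervalIntegral.tendsto_integral_filter_of_dominated_convergence (fun _ => 7 * B)
      ?_ ?_ (by simp) ?_
    · filter_upwards [self_mem_nhdsWithin] with t ht
      refine Continuous.aestronglyMeasurable ?_
      refine Continuous.mul ?_ (continuous_im.comp
        (hG.continuousOn.comp_continuous (by fun_prop) fun x => hY.trans_le (hmim t ht x)))
      rw [show P t = fun x => _ from funext (hP t ht)]
      exact Continuous.div (by fun_prop) (by fun_prop) fun x => hden0 _
    · filter_upwards [self_mem_nhdsWithin] with t ht
      refine Eventually.of_forall fun x _ => ?_
      rw [norm_mul, hP t ht]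
      refine mul_le_mul ?_ ((abs_im_le_norm _).trans (hB _ (hmim t ht x))) (norm_nonneg _)
        (by norm_num)
      rw [Real.norm_of_nonneg (by positivity), div_le_iff₀ (pow_pos (lt_of_lt_of_le (by norm_num)
        (hden (t * x))) 2)]
      nlinarith [hden (t * x)]
    · refine Eventually.of_forall fun x _ => Tendsto.mul ?_ ?_
      · have h1 : ContinuousAt (fun t : ℝ => (7 / 16 : ℝ) / ‖exp ((t * x : ℝ) * I) - 3 / 4‖ ^ 2) 0 :=
          ContinuousAt.div (by fun_prop) (by fun_prop) (hden0 _)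
        have h2 : Tendsto _ (𝓝[>] (0 : ℝ)) _ := h1.tendsto.mono_left nhdsWithin_le_nhds
        have h3 : (7 / 16 : ℝ) / ‖exp (((0 : ℝ) * x : ℝ) * I) - 3 / 4‖ ^ 2 = 7 := by
          simp only [zero_mul, ofReal_zero, exp_zero]
          norm_num
        rw [h3] at h2
        refine h2.congr' ?_
        filter_upwards [self_mem_nhdsWithin] with t ht
        exact (hP t ht x).symm
      · have h1 : ContinuousAt G (x + Y * I) :=
          (hG.differentiableAt ((isOpen_HP Y₀).mem_nhds (by
            show Y₀ < _
            simpa using hY))).continuousAt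
        exact (continuous_im.continuousAt.comp h1).tendsto.comp (tendsto_circleMap_bottom Y x)
  have hlim2 : Tendsto (fun t : ℝ => 2 * Real.pi * t⁻¹ * (G ((Y + t⁻¹ / 4 : ℝ) * I)).im) (𝓝[>] 0)
      (𝓝 (8 * Real.pi * γ)) := by
    have h1 : Tendsto (fun R : ℝ => Y + R / 4) atTop atTop :=
      tendsto_atTop_add_const_left _ _ (tendsto_id.atTop_div_const (by norm_num))
    have h2 := hγ.comp h1
    have h3 : Tendsto (fun R : ℝ => R / (Y + R / 4)) atTop (𝓝 4) := by
      have h4 : Tendsto (fun R : ℝ => (Y / R + 1 / 4)⁻¹) atTop (𝓝 (0 + 1 / 4)⁻¹) :=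
        ((tendsto_const_nhds.div_atTop tendsto_id).add_const _).inv₀ (by norm_num)
      norm_num at h4
      refine h4.congr' ?_
      filter_upwards [eventually_gt_atTop 0] with R hR
      have : Y / R + 1 / 4 = (Y + R / 4) / R := by field_simp
      rw [this, inv_div]
    have h5 := (h3.mul h2).const_mul (2 * Real.pi)
    have h6 : 2 * Real.pi * (4 * γ) = 8 * Real.pi * γ := by ring
    rw [h6] at h5
    have h7 : Tendsto (fun R : ℝ => 2 * Real.pi * R * (G ((Y + R / 4 : ℝ) * I)).im) atTop
        (𝓝 (8 * Real.pi * γ)) := by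
      refine h5.congr' ?_
      filter_upwards [h1.eventually_gt_atTop 0] with R hR
      simp only [Function.comp_apply]
      rw [← mul_assoc (R / _), div_mul_cancel₀ _ hR.ne', mul_assoc (2 * Real.pi)]
    exact h7.comp tendsto_inv_nhdsGT_zero
  have hle : ∀ᶠ t in 𝓝[>] (0 : ℝ), ∫ x in -X..X, P t x * (G (m t x)).im ≤
      2 * Real.pi * t⁻¹ * (G ((Y + t⁻¹ / 4 : ℝ) * I)).im := by
    have hXlarge : ∀ᶠ t in 𝓝[>] (0 : ℝ), X ≤ Real.pi * t⁻¹ :=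
      (tendsto_inv_nhdsGT_zero.const_mul_atTop Real.pi_pos).eventually_ge_atTop X
    filter_upwards [hXlarge, self_mem_nhdsWithin] with t h1 ht
    have ht' : 0 < t⁻¹ := inv_pos.2 ht
    have hsub : closedBall ((Y + t⁻¹ : ℝ) * I : ℂ) t⁻¹ ⊆ HP Y₀ := by
      intro z hz
      rw [mem_closedBall, dist_eq_norm] at hz
      have h2 := (neg_abs_le _).trans' (neg_le_neg ((abs_im_le_norm _).trans hz))
      simp only [sub_im, im_ofReal_mul, I_im, mul_one] at h2
      show Y₀ < z.im
      linarith
    refine integral_poissonKernel_mul_im_le (isOpen_HP Y₀) hG hsub (fun z hz => him z (hsub hz)) ht'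
      ?_ hX h1
    have e2 : ((Y + t⁻¹ / 4 : ℝ) * I - (Y + t⁻¹ : ℝ) * I : ℂ) = (t⁻¹ : ℝ) * (-I * (3 / 4)) := by
      push_cast; ring
    rw [mem_ball, dist_eq_norm, e2]
    simp only [norm_mul, norm_neg, norm_I, one_mul, norm_real, Real.norm_of_nonneg ht'.le]
    norm_num
    linarith
  have := le_of_tendsto_of_tendsto hlim1 hlim2 hle
  rw [intervalIntegral.integral_const_mul] at this
  linarith

section

variable {N : ℕ} {w : Fin N → ℂ} {b : Fin N → ℝ} {G : ℂ → ℂ}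

lemma IsSlitFamily.subset_closure_slitDomain : UHP ⊆ closure (slitDomain w b) := by
  intro z hz
  have h1 : ∀ᶠ t in 𝓝[>] (0 : ℝ), ∀ j, (w j).im ≠ z.im + t := by
    refine eventually_all.2 fun j => ?_
    by_cases hj : (w j).im ≤ z.im
    · filter_upwards [self_mem_nhdsWithin] with t ht
      have : 0 < t := ht
      linarith
    · have hlt : ∀ᶠ t in 𝓝 (0 : ℝ), t < (w j).im - z.im :=
        eventually_lt_nhds (sub_pos.2 (not_le.1 hj))
      filter_upwards [nhdsWithin_le_nhds hlt] with t ht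
      linarith
  have h2 : ∀ᶠ t : ℝ in 𝓝[>] (0 : ℝ), z + t * I ∈ slitDomain w b := by
    filter_upwards [h1, self_mem_nhdsWithin] with t ht ht0
    have ht0 : 0 < t := ht0
    have hz : 0 < z.im := hz
    refine mem_slitDomain_of_im_lt (by simpa using by linarith) fun j => ?_
    simpa using ht j
  have h3 : Tendsto (fun t : ℝ => z + t * I) (𝓝[>] 0) (𝓝 z) := by
    have : ContinuousAt (fun t : ℝ => z + t * I) 0 := by fun_prop
    simpa using this.tendsto.mono_left nhdsWithin_le_nhds
  exact mem_closure_of_tendsto h3 h2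

/-- If `Im G` is asymptotically constant at each slit, it extends continuously to `ℍ`. -/
lemma IsSlitFamily.exists_continuousOn_im (h : IsSlitFamily w b)
    (hG : DifferentiableOn ℂ G (slitDomain w b))
    (hc : ∀ j, ∃ c, Tendsto (fun ζ => (G (slitMap (w j) (b j) ζ)).im) outerNhds (𝓝 c)) :
    ∃ H : ℂ → ℝ, ContinuousOn H UHP ∧ ∀ z ∈ slitDomain w b, H z = (G z).im := by
  have hcont : ∀ z ∈ slitDomain w b, ContinuousAt (fun z => (G z).im) z := fun z hz =>
    continuous_im.continuousAt.comp
      (hG.differentiableAt (h.isOpen_slitDomain.mem_nhds hz)).continuousAt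
  refine ⟨extendFrom (slitDomain w b) fun z => (G z).im,
    continuousOn_extendFrom subset_closure_slitDomain fun z hz => ?_, fun z hz =>
    extendFrom_eq (subset_closure hz) ((hcont z hz).mono_left nhdsWithin_le_nhds)⟩
  by_cases hzD : z ∈ slitDomain w b
  · exact ⟨_, (hcont z hzD).mono_left nhdsWithin_le_nhds⟩
  obtain ⟨j, hj⟩ : ∃ j, z ∈ slitSeg (w j) (b j) := by
    by_contra hcon
    exact hzD ⟨hz, fun h' => hcon (mem_iUnion.1 h')⟩
  obtain ⟨c, hc⟩ := hc j
  refine ⟨c, fun s hs => ?_⟩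
  obtain ⟨r, hr, hrs⟩ := eventually_outerNhds_iff.1 (hc hs)
  have hopen : IsOpen {z | focalSum (w j) (b j) z < b j * (r + r⁻¹)} := by
    refine isOpen_lt ?_ continuous_const
    unfold focalSum
    fun_prop
  have hmem : z ∈ {z | focalSum (w j) (b j) z < b j * (r + r⁻¹)} := by
    rw [← slitEllipse_one (h.pos j)] at hj
    exact lt_of_le_of_lt hj (mul_lt_mul_of_pos_left (add_inv_lt_add_inv le_rfl hr) (h.pos j))
  rw [mem_map]
  filter_upwards [mem_nhdsWithin_of_mem_nhds (hopen.mem_nhds hmem), self_mem_nhdsWithin] with p hp hpD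
  obtain ⟨ζ, hζ, rfl⟩ := exists_slitMap_eq (h.pos j) fun h' => hpD.2 (mem_iUnion.2 ⟨j, h'⟩)
  refine hrs ζ ⟨hζ, ?_⟩
  change focalSum _ _ _ < _ at hp
  rw [focalSum_slitMap (h.pos j) (norm_pos_iff.1 (zero_lt_one.trans hζ)),
    mul_lt_mul_iff_right₀ (h.pos j)] at hp
  exact (add_inv_lt_iff hζ.le hr.le).1 hp

/-- Imaginary part of Cauchy's theorem on a rectangle. -/
lemma integral_im_rect {X y₁ y₂ : ℝ} (hG : DifferentiableOn ℂ G (Icc (-X) X ×ℂ uIcc y₁ y₂))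
    (hX : 0 ≤ X) :
    ∫ x in -X..X, (G (x + y₂ * I)).im = (∫ x in -X..X, (G (x + y₁ * I)).im) +
      ∫ y in y₁..y₂, ((G (X + y * I)).re - (G (-X + y * I)).re) := by
  have hXX : -X ≤ X := by linarith
  have key := integral_boundary_rect_eq_zero_of_differentiableOn G (-X + y₁ * I) (X + y₂ * I)
    (by simpa [uIcc_of_le hXX] using hG)
  simp only [add_re, neg_re, ofReal_re, re_ofReal_mul, I_re, mul_zero, add_zero, add_im, neg_im,
    ofReal_im, im_ofReal_mul, I_im, mul_one, zero_add, neg_zero, ofReal_neg] at key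
  have hh : ∀ y ∈ uIcc y₁ y₂, IntervalIntegrable (fun x : ℝ => G (x + y * I)) volume (-X) X := by
    intro y hy
    refine ContinuousOn.intervalIntegrable (hG.continuousOn.comp (by fun_prop) fun x hx => ?_)
    rw [uIcc_of_le hXX] at hx
    exact ⟨by simpa using hx, by simpa using hy⟩
  have hv : ∀ x ∈ Icc (-X) X, IntervalIntegrable (fun y : ℝ => G (x + y * I)) volume y₁ y₂ := by
    intro x hx
    refine ContinuousOn.intervalIntegrable (hG.continuousOn.comp (by fun_prop) fun y hy => ?_)
    exact ⟨by simpa using hx, by simpa using hy⟩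
  have hv1 := hv X ⟨hXX, le_rfl⟩
  have hv2 := hv (-X) ⟨le_rfl, hXX⟩
  have him := congrArg Complex.im key
  have e1 := fun y hy => imCLM.intervalIntegral_comp_comm (hh y hy)
  have e2 := reCLM.intervalIntegral_comp_comm hv1
  have e3 := reCLM.intervalIntegral_comp_comm hv2
  simp only [imCLM_apply, reCLM_apply, ofReal_neg] at e1 e2 e3
  simp only [sub_im, add_im, smul_eq_mul, I_mul_im, zero_im] at him
  rw [← e1 _ left_mem_uIcc, ← e1 _ right_mem_uIcc, ← e2, ← e3] at him
  rw [intervalIntegral.integral_sub ?_ ?_]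
  · linarith
  · exact ⟨hv1.1.re, hv1.2.re⟩
  · rw [ofReal_neg] at hv2
    exact ⟨hv2.1.re, hv2.2.re⟩

/-- Conservation of the flux of `Im G` through horizontal lines, across slits. -/
lemma IsSlitFamily.integral_flux (h : IsSlitFamily w b) (hG : DifferentiableOn ℂ G (slitDomain w b))
    (hc : ∀ j, ∃ c, Tendsto (fun ζ => (G (slitMap (w j) (b j) ζ)).im) outerNhds (𝓝 c))
    {a Y X : ℝ} (ha0 : 0 < a) (ha : ∀ j, a < (w j).im) (haY : a ≤ Y) (hY : ∀ j, (w j).im < Y)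
    (hX0 : 0 ≤ X) (hX : ∀ z : ℂ, 0 < z.im → X ≤ |z.re| → z ∈ slitDomain w b) :
    ∫ x in -X..X, (G (x + Y * I)).im = (∫ x in -X..X, (G (x + a * I)).im) +
      ∫ y in a..Y, ((G (X + y * I)).re - (G (-X + y * I)).re) := by
  obtain ⟨H, hHc, hH⟩ := h.exists_continuousOn_im hG hc
  set J : ℝ → ℝ := fun y => ∫ x in -X..X, H (x + y * I) with hJ
  set U : ℝ → ℝ := fun y => (G (X + y * I)).re - (G (-X + y * I)).re with hU
  have hUc : ContinuousOn U (Ioi 0) := by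
    have h1 : ∀ x : ℝ, X ≤ |x| → ContinuousOn (fun y : ℝ => (G (x + y * I)).re) (Ioi 0) := by
      intro x hx
      refine continuous_re.comp_continuousOn (hG.continuousOn.comp (by fun_prop) fun y hy => ?_)
      exact hX _ (by simpa using hy) (by simpa using hx)
    have h2 := h1 (-X) (by simpa using le_abs_self X)
    rw [ofReal_neg] at h2
    exact (h1 X (le_abs_self X)).sub h2
  have hline : ∀ y, 0 < y → (∀ j, (w j).im ≠ y) → J y = ∫ x in -X..X, (G (x + y * I)).im := by
    intro y hy hj
    refine intervalIntegral.integral_congr fun x _ => hH _ ?_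
    exact mem_slitDomain_of_im_lt (by simpa using hy) (by simpa using hj)
  have hUint : ∀ y₁ y₂, 0 < y₁ → 0 < y₂ → IntervalIntegrable U volume y₁ y₂ := fun y₁ y₂ h1 h2 =>
    (hUc.mono fun y hy => (lt_min h1 h2).trans_le hy.1).intervalIntegrable
  have hJc : ContinuousOn J (Icc a Y) := by
    have h1 : Continuous fun y : ℝ => ∫ x in -X..X, H (x + (max y a : ℝ) * I) := by
      refine intervalIntegral.continuous_parametric_intervalIntegral_of_continuous' ?_ _ _
      refine hHc.comp_continuous (by fun_prop) fun p => ?_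
      show 0 < ((p.2 : ℂ) + ((max p.1 a : ℝ) : ℂ) * I).im
      simp [ha0]
    refine h1.continuousOn.congr fun y hy => ?_
    simp only [hJ, max_eq_left hy.1]
  have hFc : ContinuousOn (fun y => J y - ∫ t in a..y, U t) (Icc a Y) := by
    refine hJc.sub ?_
    have := intervalIntegral.continuousOn_primitive_interval
      ((intervalIntegrable_iff' (by simp)).1 (hUint a Y ha0 (ha0.trans_le haY)))
    rwa [uIcc_of_le haY] at this
  have hd : ∀ y ∈ Ioo a Y \ range (fun j => (w j).im),
      HasDerivAt (fun y => J y - ∫ t in a..y, U t) 0 y := by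
    rintro y ⟨hy, hyr⟩
    have hnear : Ioo a Y ∩ (range fun j => (w j).im)ᶜ ∈ 𝓝 y :=
      inter_mem (isOpen_Ioo.mem_nhds hy)
        ((finite_range _).isClosed.isOpen_compl.mem_nhds hyr)
    obtain ⟨δ, hδ, hball⟩ := Metric.mem_nhds_iff.1 hnear
    refine (hasDerivAt_const y (J y - ∫ t in a..y, U t)).congr_of_eventuallyEq ?_
    filter_upwards [ball_mem_nhds y hδ] with y' hy'
    have hsub : uIcc y y' ⊆ ball y δ := by
      rw [Real.ball_eq_Ioo] at hy' ⊢
      exact ordConnected_Ioo.uIcc_subset ⟨by linarith, by linarith⟩ hy'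
    have hpos : ∀ t ∈ uIcc y y', 0 < t := fun t ht => ha0.trans (hball (hsub ht)).1.1
    have hne : ∀ t ∈ uIcc y y', ∀ j, (w j).im ≠ t := fun t ht j e =>
      (hball (hsub ht)).2 ⟨j, e⟩
    have h1 := integral_im_rect (G := G) (X := X) (y₁ := y) (y₂ := y') (hG.mono fun z hz =>
      mem_slitDomain_of_im_lt (hpos _ hz.2) (hne _ hz.2)) hX0
    rw [← hline y (hpos y left_mem_uIcc) (hne y left_mem_uIcc),
      ← hline y' (hpos y' right_mem_uIcc) (hne y' right_mem_uIcc)] at h1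
    have h2 := intervalIntegral.integral_add_adjacent_intervals
      (hUint a y ha0 (hpos y left_mem_uIcc))
      (hUint y y' (hpos y left_mem_uIcc) (hpos y' right_mem_uIcc))
    rw [h1, ← h2]
    ring
  have := integral_eq_of_hasDerivAt_off_countable_of_le _ (fun _ => (0 : ℝ)) haY
    (finite_range fun j => (w j).im).countable hFc hd (by simp)
  simp only [intervalIntegral.integral_zero, intervalIntegral.integral_same, sub_zero] at this
  rw [← hline Y (ha0.trans_le haY) fun j => (hY j).ne, ← hline a ha0 fun j => (ha j).ne']
  linarith

/-- Flux comparison in the limit of long horizontal segments. -/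
lemma IsSlitFamily.exists_integral_im_le (h : IsSlitFamily w b)
    (hG : DifferentiableOn ℂ G (slitDomain w b))
    (hc : ∀ j, ∃ c, Tendsto (fun ζ => (G (slitMap (w j) (b j) ζ)).im) outerNhds (𝓝 c))
    {a Y : ℝ} (ha0 : 0 < a) (ha : ∀ j, a < (w j).im) (haY : a ≤ Y) (hY : ∀ j, (w j).im < Y)
    (hinf : ∀ ε > 0, ∃ R, ∀ z : ℂ, a ≤ z.im → R < ‖z‖ → ‖G z‖ ≤ ε) {ε : ℝ} (hε : 0 < ε) :
    ∃ X₀, ∀ X ≥ X₀, ∫ x in -X..X, (G (x + a * I)).im ≤ (∫ x in -X..X, (G (x + Y * I)).im) + ε := by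
  obtain ⟨X₁, hX₁, hfar⟩ := exists_far w b
  have hYa : 0 < Y - a + 1 := by linarith
  obtain ⟨R, hR⟩ := hinf (ε / (2 * (Y - a + 1))) (by positivity)
  refine ⟨max (X₁ + 1) (R + 1), fun X hX => ?_⟩
  have h1 := (le_max_left _ _).trans hX
  have h2 := (le_max_right _ _).trans hX
  have hX0 : 0 ≤ X := by linarith
  rw [h.integral_flux hG hc ha0 ha haY hY hX0 fun z hz hzX => hfar z hz (by linarith)]
  have hb : ∀ y ∈ Set.uIoc a Y, ‖(G (X + y * I)).re - (G (-X + y * I)).re‖ ≤ ε / (Y - a + 1) := by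
    intro y hy
    rw [uIoc_of_le haY] at hy
    have h3 : ∀ x : ℝ, |x| = X → |(G (x + y * I)).re| ≤ ε / (2 * (Y - a + 1)) := by
      intro x hx
      refine (abs_re_le_norm _).trans (hR _ (by simpa using hy.1.le) ?_)
      have := abs_re_le_norm (x + y * I : ℂ)
      simp only [add_re, ofReal_re, re_ofReal_mul, I_re, mul_zero, add_zero, hx] at this
      linarith
    have h4 := h3 X (abs_of_nonneg hX0)
    have h5 := h3 (-X) (by rw [abs_neg, abs_of_nonneg hX0])
    rw [ofReal_neg] at h5
    have h6 : ε / (Y - a + 1) = ε / (2 * (Y - a + 1)) + ε / (2 * (Y - a + 1)) := by field_simp; ring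
    rw [Real.norm_eq_abs, h6]
    exact (abs_sub _ _).trans (add_le_add h4 h5)
  have h7 := intervalIntegral.norm_integral_le_of_norm_le_const hb
  rw [Real.norm_eq_abs, abs_of_nonneg (by linarith : 0 ≤ Y - a)] at h7
  have h8 : ε / (Y - a + 1) * (Y - a) ≤ ε := by
    rw [div_mul_eq_mul_div, div_le_iff₀ hYa]; nlinarith
  have h9 := (neg_abs_le _).trans' (neg_le_neg (h7.trans h8))
  linarith

end

section

variable {N : ℕ} {w : Fin N → ℂ} {b : Fin N → ℝ} {G : ℂ → ℂ}

/-- If `Im G ≥ 0` in a strip, the variation of `G` along the middle line is controlled by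
the integral of `Im G`. -/
lemma two_mul_norm_le_of_strip {a x X : ℝ} (ha : 0 < a)
    (hG : DifferentiableOn ℂ G {z | 0 < z.im ∧ z.im < 2 * a})
    (him : ∀ z : ℂ, 0 < z.im → z.im < 2 * a → 0 ≤ (G z).im) (hx : x ∈ Icc (-X) X) :
    2 * ‖G (x + a * I)‖ ≤ ‖G (X + a * I)‖ + ‖G (-X + a * I)‖ +
      2 / a * ∫ t in -X..X, (G (t + a * I)).im := by
  have hopen : IsOpen {z : ℂ | 0 < z.im ∧ z.im < 2 * a} :=
    (isOpen_lt continuous_const continuous_im).inter (isOpen_lt continuous_im continuous_const)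
  have hmem : ∀ t : ℝ, (t + a * I : ℂ) ∈ {z : ℂ | 0 < z.im ∧ z.im < 2 * a} := fun t => by
    show 0 < (t + a * I : ℂ).im ∧ (t + a * I : ℂ).im < 2 * a
    simpa using ⟨ha, by linarith⟩
  have hderiv : ∀ t : ℝ, HasDerivAt (fun t : ℝ => G (t + a * I)) (deriv G (t + a * I)) t := by
    intro t
    have h1 := (hG.differentiableAt (hopen.mem_nhds (hmem t))).hasDerivAt
    have h2 : HasDerivAt (fun s : ℂ => s + a * I) 1 (t : ℂ) := (hasDerivAt_id _).add_const _
    simpa using (h1.comp (t : ℂ) h2).comp_ofReal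
  have hdc : Continuous fun t : ℝ => deriv G (t + a * I) :=
    (hG.deriv hopen).continuousOn.comp_continuous (by fun_prop) hmem
  have hic : Continuous fun t : ℝ => (G (t + a * I)).im :=
    continuous_im.comp (hG.continuousOn.comp_continuous (by fun_prop) hmem)
  have hbound : ∀ t : ℝ, ‖deriv G (t + a * I)‖ ≤ 2 / a * (G (t + a * I)).im := by
    intro t
    have hball : ∀ ζ ∈ ball (t + a * I : ℂ) a, 0 < ζ.im ∧ ζ.im < 2 * a := by
      intro ζ hζ
      have := (abs_im_lt_of_mem_ball hζ).1
      simp only [add_im, ofReal_im, im_ofReal_mul, I_im, mul_one, zero_add] at this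
      rw [abs_lt] at this
      constructor <;> linarith
    exact norm_deriv_le_of_im_nonneg ha (hG.mono hball) fun ζ hζ =>
      him ζ (hball ζ hζ).1 (hball ζ hζ).2
  have hvar : ∀ p q : ℝ, p ≤ q → ‖G (q + a * I) - G (p + a * I)‖ ≤
      2 / a * ∫ t in p..q, (G (t + a * I)).im := by
    intro p q hpq
    rw [← intervalIntegral.integral_eq_sub_of_hasDerivAt (fun t _ => hderiv t)
      (hdc.intervalIntegrable _ _), ← intervalIntegral.integral_const_mul]
    exact intervalIntegral.norm_integral_le_of_norm_le hpq
      (Eventually.of_forall fun t _ => hbound t) ((hic.const_mul _).intervalIntegrable _ _)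
  have h1 := hvar x X hx.2
  have h2 := hvar (-X) x hx.1
  rw [ofReal_neg] at h2
  have h3 := intervalIntegral.integral_add_adjacent_intervals
    (hic.intervalIntegrable (-X) x) (hic.intervalIntegrable (μ := volume) x X)
  have h4 := norm_sub_norm_le (G (x + a * I)) (G (X + a * I))
  have h5 := norm_sub_norm_le (G (x + a * I)) (G (-X + a * I))
  rw [norm_sub_rev] at h4
  rw [← h3, mul_add]
  linarith

/-- Decay at infinity gives boundedness on half-planes above the slits. -/
lemma exists_norm_le_of_im_ge (hG : DifferentiableOn ℂ G (slitDomain w b)) {Y : ℝ} (hY0 : 0 < Y) (hY : ∀ j, (w j).im < Y)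
    (hinf : ∀ ε > 0, ∃ R, ∀ z : ℂ, Y ≤ z.im → R < ‖z‖ → ‖G z‖ ≤ ε) :
    ∃ B, ∀ z : ℂ, Y ≤ z.im → ‖G z‖ ≤ B := by
  obtain ⟨R, hR⟩ := hinf 1 one_pos
  have hK : IsCompact (closedBall (0 : ℂ) R ∩ {z | Y ≤ z.im}) :=
    (isCompact_closedBall _ _).inter_right (isClosed_le continuous_const continuous_im)
  obtain ⟨B, hB⟩ := hK.exists_bound_of_continuousOn (f := G) (hG.continuousOn.mono fun z hz =>
    mem_slitDomain_of_im_lt (hY0.trans_le hz.2) fun j => ((hY j).trans_le hz.2).ne)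
  refine ⟨max 1 B, fun z hz => ?_⟩
  by_cases hzR : R < ‖z‖
  · exact (hR z hz hzR).trans (le_max_left _ _)
  · exact (hB z ⟨mem_closedBall_zero_iff.2 (not_lt.1 hzR), hz⟩).trans (le_max_right _ _)

/-- A function with nonnegative imaginary part, constant on each slit, is bounded in terms of its
angular residue. -/
theorem IsSlitFamily.norm_le_of_residue (h : IsSlitFamily w b)
    (hG : DifferentiableOn ℂ G (slitDomain w b)) (him : ∀ z ∈ slitDomain w b, 0 ≤ (G z).im)
    (hc : ∀ j, ∃ c, Tendsto (fun ζ => (G (slitMap (w j) (b j) ζ)).im) outerNhds (𝓝 c))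
    {η₁ : ℝ} (hinf : ∀ ε > 0, ∃ R, ∀ z : ℂ, η₁ ≤ z.im → R < ‖z‖ → ‖G z‖ ≤ ε)
    {γ : ℝ} (hγ : Tendsto (fun y : ℝ => y * (G (y * I)).im) atTop (𝓝 γ))
    {η : ℝ} (hη : 0 < η) (hηw : ∀ j, η < (w j).im) {z : ℂ} (hz : z ∈ slitDomain w b)
    (hzη : η < z.im) : ‖G z‖ ≤ 12 / η * γ := by
  have ha : 0 < η / 2 := half_pos hη
  set a := η / 2 with ha'
  have haw : ∀ j, a < (w j).im := fun j => by linarith [hηw j]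
  have hdecay : ∀ y, 0 < y → ∀ ε > 0, ∃ R, ∀ z : ℂ, y ≤ z.im → R < ‖z‖ → ‖G z‖ ≤ ε :=
    fun y hy ε hε => tendsto_zero_of_im_nonneg hG him hinf hy hε
  obtain ⟨Y₀, hY₀, hY₀w⟩ := exists_top w a
  have hYa : a < Y₀ + 1 := by linarith
  have hYw : ∀ j, (w j).im < Y₀ + 1 := fun j => by linarith [hY₀w j]
  have hHP : HP Y₀ ⊆ slitDomain w b := fun z hz => by
    have hz : Y₀ < z.im := hz
    exact mem_slitDomain_of_im_lt (by linarith) fun j => ((hY₀w j).trans hz).ne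
  obtain ⟨B, hB⟩ := exists_norm_le_of_im_ge hG (by linarith) hYw (hdecay _ (by linarith))
  have hstrip : {z : ℂ | 0 < z.im ∧ z.im < 2 * a} ⊆ slitDomain w b := fun z hz =>
    mem_slitDomain_of_im_lt hz.1 fun j => by linarith [hηw j, hz.2]
  set M := 16 * Real.pi / 7 * (γ / η) with hM
  have hline : ∀ z : ℂ, z.im = a → ‖G z‖ ≤ M := by
    intro z hza
    have hz : z = z.re + a * I := by rw [← hza, re_add_im]
    refine le_of_forall_pos_le_add fun ε hε => ?_
    obtain ⟨X₀, hX₀⟩ := h.exists_integral_im_le hG hc ha haw hYa.le hYw (hdecay a ha)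
      (show 0 < ε * a / 2 by positivity)
    obtain ⟨R, hR⟩ := hdecay a ha (ε / 2) (half_pos hε)
    set X := max X₀ (max |z.re| (R + 1))
    have hXz : |z.re| ≤ X := (le_max_left _ _).trans (le_max_right _ _)
    have hXR : R + 1 ≤ X := (le_max_right _ _).trans (le_max_right _ _)
    have hX : 0 ≤ X := (abs_nonneg _).trans hXz
    have h1 := hX₀ X (le_max_left _ _)
    have h2 := integral_im_le_of_residue (lt_add_one Y₀) (hG.mono hHP) (fun z hz => him z (hHP hz))
      hB hγ hX
    have h3 := two_mul_norm_le_of_strip ha (hG.mono hstrip) (fun z h0 h2 => him z (hstrip ⟨h0, h2⟩))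
      (abs_le.1 hXz)
    have h4 : ∀ x : ℝ, |x| = X → ‖G (x + a * I)‖ ≤ ε / 2 := by
      intro x hx
      refine hR _ (by simp) ?_
      have := abs_re_le_norm (x + a * I : ℂ)
      simp only [add_re, ofReal_re, re_ofReal_mul, I_re, mul_zero, add_zero, hx] at this
      linarith
    have h5 := h4 X (abs_of_nonneg hX)
    have h6 := h4 (-X) (by rw [abs_neg, abs_of_nonneg hX])
    rw [ofReal_neg] at h6
    rw [← hz] at h3
    have h7 : 2 / a * ∫ t in -X..X, (G (t + a * I)).im ≤ 2 / a * (8 * Real.pi / 7 * γ + ε * a / 2) :=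
      mul_le_mul_of_nonneg_left (by linarith) (by positivity)
    have h8 : 2 / a * (8 * Real.pi / 7 * γ + ε * a / 2) = 2 * M + ε := by
      rw [hM, ha']; field_simp; ring
    linarith
  have hM0 : 0 ≤ M := (norm_nonneg _).trans (hline (a * I) (by simp))
  have hre : ∀ W : ℂ → ℂ, DifferentiableOn ℂ W (slitDomain w b) → (∀ z, ‖W z‖ = ‖G z‖) →
      (∀ j, SlitMaxPrinciple (w j) (b j) W) → (W z).re ≤ M := by
    intro W hW hWG hS
    have hle : ∀ z, (W z).re ≤ ‖G z‖ := fun z => hWG z ▸ re_le_norm (W z)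
    refine h.re_le ha haw hW hS (fun z hz => (hle z).trans (hline z hz)) ?_ z hz (by linarith)
    intro ε hε
    obtain ⟨R, hR⟩ := hdecay a ha ε hε
    exact ⟨R, fun z _ hz1 hz2 => by linarith [hle z, hR z hz1 hz2]⟩
  have hpm : ∀ W : ℂ → ℂ, DifferentiableOn ℂ W (slitDomain w b) → (∀ z, ‖W z‖ = ‖G z‖) →
      (∀ j, ∃ c, Tendsto (fun ζ => (W (slitMap (w j) (b j) ζ)).im) outerNhds (𝓝 c)) →
      (W z).re ≤ M ∧ (W z).im ≤ M := by
    intro W hW hWG hWc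
    refine ⟨hre W hW hWG fun j => h.slitMaxPrinciple_of_re hW (hWc j).choose_spec, ?_⟩
    simpa using hre _ (hW.const_mul (-I)) (fun z => by simp [hWG])
      fun j => h.slitMaxPrinciple_of_im hW (hWc j).choose_spec
  have hp := hpm G hG (fun _ => rfl) hc
  have hn := hpm (fun z => -G z) hG.fun_neg (fun z => norm_neg _) fun j =>
    ⟨-(hc j).choose, by simpa using (hc j).choose_spec.neg⟩
  simp only [neg_re, neg_im] at hn
  have hγη : 0 ≤ γ / η := by
    have := Real.pi_pos
    rw [hM] at hM0
    exact nonneg_of_mul_nonneg_right hM0 (by positivity)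
  have hsq : ‖G z‖ ^ 2 ≤ (12 / η * γ) ^ 2 := by
    have h1 : (G z).re ^ 2 ≤ M ^ 2 := sq_le_sq' (by linarith [hn.1]) hp.1
    have h2 : (G z).im ^ 2 ≤ M ^ 2 := sq_le_sq' (by linarith [hn.2]) hp.2
    have h3 : M ^ 2 ≤ 72 * (γ / η) ^ 2 := by
      rw [hM, mul_pow]
      have := Real.pi_lt_d2
      have := Real.pi_pos
      gcongr
      nlinarith
    have h4 : (12 / η * γ) ^ 2 = 144 * (γ / η) ^ 2 := by ring
    rw [← normSq_eq_norm_sq, normSq_apply]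
    linarith
  refine le_of_sq_le_sq hsq ?_
  rw [div_mul_eq_mul_div, mul_div_assoc]
  positivity

end

section

variable {f g : ℂ → ℂ} {c c' : ℂ}

lemma tendsto_ofReal_mul_I_cobounded : Tendsto (fun y : ℝ => (y * I : ℂ)) atTop (cobounded ℂ) := by
  rw [← tendsto_norm_atTop_iff_cobounded]
  refine tendsto_abs_atTop_atTop.congr fun y => by simp

lemma tendsto_cobounded_of_sub {ι : Type*} {l : Filter ι} {u v : ι → ℂ}
    (huv : Tendsto (fun i => u i - v i) l (𝓝 0)) (hv : Tendsto v l (cobounded ℂ)) :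
    Tendsto u l (cobounded ℂ) := by
  rw [← tendsto_norm_atTop_iff_cobounded] at hv ⊢
  refine tendsto_atTop_mono (fun i => ?_) (hv.atTop_add huv.norm.neg)
  have := norm_sub_norm_le (v i) (u i)
  rw [norm_sub_rev] at this
  linarith

lemma SatisfiesH2.tendsto_of_asymptotic (hf : SatisfiesH2 f c) {u : ℝ → ℂ}
    (hu : Tendsto (fun y => u y - y * I) atTop (𝓝 0)) :
    Tendsto (fun y => u y * (f (u y) - u y)) atTop (𝓝 (-c)) := by
  have h1 : Tendsto (fun y => u y / y) atTop (𝓝 I) := by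
    have h2 : Tendsto (fun y : ℝ => ((y⁻¹ : ℝ) : ℂ)) atTop (𝓝 0) := by
      have := (continuous_ofReal.tendsto 0).comp (tendsto_inv_atTop_zero (𝕜 := ℝ))
      rwa [ofReal_zero] at this
    have h3 := (hu.mul h2).add_const I
    rw [zero_mul, zero_add] at h3
    refine h3.congr' ?_
    filter_upwards [eventually_gt_atTop 0] with y hy
    have : (y : ℂ) ≠ 0 := ofReal_ne_zero.2 hy.ne'
    push_cast
    field_simp
    ring
  have h4 : Tendsto (fun y => arg (u y)) atTop (𝓝 (Real.pi / 2)) := by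
    have h5 : Tendsto (fun y => arg (u y / y)) atTop (𝓝 (arg I)) :=
      (continuousAt_arg (by simp [mem_slitPlane_iff])).tendsto.comp h1
    rw [arg_I] at h5
    refine h5.congr' ?_
    filter_upwards [eventually_gt_atTop 0] with y hy
    rw [div_eq_mul_inv, mul_comm, ← ofReal_inv, arg_real_mul _ (inv_pos.2 hy)]
  have hpi := Real.pi_pos
  have h6 : ∀ᶠ y in atTop, u y ∈ Sector (Real.pi / 4) :=
    (h4.eventually (Ioo_mem_nhds (show Real.pi / 4 < Real.pi / 2 by linarith)
      (show Real.pi / 2 < Real.pi - Real.pi / 4 by linarith)))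
  have h7 : Tendsto u atTop (cobounded ℂ) :=
    tendsto_cobounded_of_sub hu tendsto_ofReal_mul_I_cobounded
  exact (hf (Real.pi / 4) (by linarith) (by linarith)).comp
    (tendsto_inf.2 ⟨h7, tendsto_principal.2 h6⟩)

lemma SatisfiesH2.tendsto_mul_I (hf : SatisfiesH2 f c) :
    Tendsto (fun y : ℝ => (y * I) * (f (y * I) - y * I)) atTop (𝓝 (-c)) :=
  hf.tendsto_of_asymptotic (by simp)

/-- Angular residues are additive under composition. -/
lemma SatisfiesH2.eq_add_of_comp {k : ℂ → ℂ} {d : ℂ} (hf : SatisfiesH2 f c)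
    (hg : SatisfiesH2 g c') (hk : SatisfiesH2 k d)
    (hfg : ∀ᶠ y : ℝ in atTop, k (y * I) = g (f (y * I))) : d = c + c' := by
  have h0 : Tendsto (fun y : ℝ => (y * I : ℂ)⁻¹) atTop (𝓝 0) :=
    tendsto_inv₀_cobounded.comp tendsto_ofReal_mul_I_cobounded
  have h1 := hf.tendsto_mul_I
  have hne : ∀ᶠ y : ℝ in atTop, (y * I : ℂ) ≠ 0 := by
    filter_upwards [eventually_gt_atTop 0] with y hy
    simp [hy.ne']
  have h2 : Tendsto (fun y : ℝ => f (y * I) - y * I) atTop (𝓝 0) := by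
    have := h0.mul h1
    rw [zero_mul] at this
    refine this.congr' ?_
    filter_upwards [hne] with y hy
    rw [inv_mul_cancel_left₀ hy]
  have h3 := hg.tendsto_of_asymptotic h2
  have h4 : Tendsto (fun y : ℝ => g (f (y * I)) - f (y * I)) atTop (𝓝 0) := by
    have h5 : Tendsto (fun y : ℝ => f (y * I)) atTop (cobounded ℂ) :=
      tendsto_cobounded_of_sub h2 tendsto_ofReal_mul_I_cobounded
    have := (tendsto_inv₀_cobounded.comp h5).mul h3
    rw [zero_mul] at this
    refine this.congr' ?_
    filter_upwards [h5.eventually (eventually_ne_cobounded 0)] with y hy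
    rw [Function.comp_apply, inv_mul_cancel_left₀ hy]
  have h6 : Tendsto (fun y : ℝ => (y * I) * (k (y * I) - y * I)) atTop (𝓝 (-c' - 0 * 0 + -c)) := by
    refine ((h3.sub (h2.mul h4)).add h1).congr' ?_
    filter_upwards [hfg] with y hy
    rw [hy]
    ring
  have := tendsto_nhds_unique hk.tendsto_mul_I h6
  linear_combination -this

/-- The leading coefficient of the imaginary part of a difference along the imaginary axis. -/
lemma SatisfiesH2.tendsto_mul_im_sub (hf : SatisfiesH2 f c) (hg : SatisfiesH2 g c') :
    Tendsto (fun y : ℝ => y * (f (y * I) - g (y * I)).im) atTop (𝓝 (c.re - c'.re)) := by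
  have h1 := (continuous_re.tendsto _).comp (hf.tendsto_mul_I.sub hg.tendsto_mul_I).neg
  have h2 : (-(-c - -c')).re = c.re - c'.re := by simp; ring
  rw [h2] at h1
  refine h1.congr fun y => ?_
  simp
  ring

end

section

variable {J : Set ℝ} {D : ℝ → Set ℂ} {φ : ℝ → ℝ → ℂ → ℂ} {lam : ℝ → ℂ}

lemma SatisfiesH1.eventually_mem {D : Set ℂ} {f : ℂ → ℂ} (hf : SatisfiesH1 D f) :
    ∀ᶠ y : ℝ in atTop, (y * I : ℂ) ∈ D := by
  obtain ⟨η, -, hη, -⟩ := hf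
  filter_upwards [eventually_gt_atTop η] with y hy
  exact hη (show η < (y * I : ℂ).im by simpa using hy)

lemma IsParallelSlitHalfPlane.subset_UHP {D : Set ℂ} (hD : IsParallelSlitHalfPlane D) :
    D ⊆ UHP := by
  obtain ⟨N, C, -, -, rfl⟩ := hD
  exact sdiff_subset

lemma tendsto_im_slitMap {N : ℕ} {w : Fin N → ℂ} {b : Fin N → ℝ} (j : Fin N) :
    Tendsto (fun ζ => (slitMap (w j) (b j) ζ).im) outerNhds (𝓝 (w j).im) := by
  rw [Metric.tendsto_nhds]
  intro ε hε
  have hb : 0 < |b j| + 1 := by positivity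
  refine eventually_outerNhds_iff.2 ⟨1 + ε / (|b j| + 1), by simp; positivity, fun ζ hζ => ?_⟩
  have h1 : 1 < ‖ζ‖ := hζ.1
  have h2 : ‖ζ‖ - 1 < ε / (|b j| + 1) := by linarith [hζ.2]
  have h3 : (slitMap (w j) (b j) ζ).im - (w j).im = b j / 2 * (ζ.im * (1 - (‖ζ‖ ^ 2)⁻¹)) := by
    have : (b j / 2 : ℂ) = ((b j / 2 : ℝ) : ℂ) := by push_cast; rfl
    rw [slitMap, this, add_im, im_ofReal_mul, add_im, inv_im, normSq_eq_norm_sq]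
    ring
  have h4 : |ζ.im * (1 - (‖ζ‖ ^ 2)⁻¹)| ≤ 2 * (‖ζ‖ - 1) := by
    have h5 : 0 ≤ 1 - (‖ζ‖ ^ 2)⁻¹ := sub_nonneg.2 (inv_le_one_of_one_le₀ (by nlinarith))
    rw [abs_mul, abs_of_nonneg h5]
    refine (mul_le_mul_of_nonneg_right (abs_im_le_norm ζ) h5).trans ?_
    have h6 : ‖ζ‖ * (1 - (‖ζ‖ ^ 2)⁻¹) = (‖ζ‖ ^ 2 - 1) / ‖ζ‖ := by field_simp
    rw [h6, div_le_iff₀ (by linarith)]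
    nlinarith
  rw [Real.dist_eq, h3, abs_mul, abs_div, abs_two]
  rw [lt_div_iff₀ hb] at h2
  nlinarith [abs_nonneg (b j)]

/-- The maps of an evolution family do not decrease imaginary parts. -/
lemma IsEvolutionFamily.im_sub_nonneg (h : IsEvolutionFamily J D φ lam) {s u : ℝ} (hs : s ∈ J)
    (hu : u ∈ J) (hsu : s ≤ u) : ∀ z ∈ D s, 0 ≤ (φ u s z - z).im := by
  obtain ⟨N, w, b, hw, hD⟩ := (h.slit s hs).exists_isSlitFamily
  obtain ⟨N', w', b', hw', hD'⟩ := (h.slit u hu).exists_isSlitFamily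
  have hd := h.holo s hs u hu hsu
  have hm := h.mapsTo s hs u hu hsu
  have hi := h.inj s hs u hu hsu
  have h1 := h.h1 s hs u hu hsu
  have h3 := h.h3 s hs u hu hsu
  obtain ⟨η₀, hη₀, hinf⟩ := h1.exists_norm_le
  have hU := (h.slit u hu).subset_UHP
  rw [hD] at hd hm hi h1 h3 ⊢
  rw [hD'] at hm h3
  refine hw.im_nonneg (g := fun z => φ u s z - z) (hd.sub differentiableOn_id) (fun z hz => ?_)
    (show 0 < η₀ + 1 by linarith) (hinf (η₀ + 1) (by linarith)) fun j => ?_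
  · have : 0 < (φ u s z).im := (hm hz).1
    simpa using this.le
  · obtain ⟨c, hc⟩ := exists_tendsto_im_slit hw hm hd hi h3 h1 j
    exact ⟨c - (w j).im, by simpa using hc.sub (tendsto_im_slitMap j)⟩

lemma IsEvolutionFamily.residue_eq_add (h : IsEvolutionFamily J D φ lam) {r t : ℝ}
    (h0 : (0 : ℝ) ∈ J) (hr : r ∈ J) (ht : t ∈ J) (hr0 : 0 ≤ r) (hrt : r ≤ t) {c : ℂ}
    (hc : SatisfiesH2 (φ t r) c) : lam t = lam r + c := by
  refine (h.lam_res r hr).eq_add_of_comp hc (h.lam_res t ht) ?_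
  filter_upwards [(h.h1 0 h0 r hr hr0).eventually_mem] with y hy
  exact h.ef2 0 h0 r hr t ht hr0 hrt _ hy

/-- Quantitative Lipschitz bound for `t ↦ φ t r`. -/
lemma IsEvolutionFamily.norm_sub_le (h : IsEvolutionFamily J D φ lam) {r s u : ℝ}
    (h0 : (0 : ℝ) ∈ J) (hr : r ∈ J) (hs : s ∈ J) (hu : u ∈ J) (hr0 : 0 ≤ r) (hrs : r ≤ s)
    (hsu : s ≤ u) {η : ℝ} (hη : 0 < η) (hηD : η < etaD (D r)) {z : ℂ} (hz : z ∈ D r)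
    (hzη : η < z.im) : ‖φ u r z - φ s r z‖ ≤ 12 / η * ((lam u).re - (lam s).re) := by
  have hru := hrs.trans hsu
  obtain ⟨cu, hcu⟩ := h.h2 r hr u hu hru
  obtain ⟨cs, hcs⟩ := h.h2 r hr s hs hrs
  have hγ := hcu.tendsto_mul_im_sub hcs
  have hlam : cu.re - cs.re = (lam u).re - (lam s).re := by
    rw [h.residue_eq_add h0 hr hu hr0 hru hcu, h.residue_eq_add h0 hr hs hr0 hrs hcs]
    simp
  rw [hlam] at hγ
  obtain ⟨N, w, b, hw, hD⟩ := (h.slit r hr).exists_isSlitFamily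
  have him : ∀ z ∈ D r, 0 ≤ (φ u r z - φ s r z).im := fun z hz => by
    rw [h.ef2 r hr s hs u hu hrs hsu z hz]
    exact h.im_sub_nonneg hs hu hsu _ (h.mapsTo r hr s hs hrs hz)
  have hd : ∀ t ∈ J, r ≤ t → DifferentiableOn ℂ (φ t r) (slitDomain w b) := fun t ht hrt =>
    hD ▸ h.holo r hr t ht hrt
  have hc : ∀ t ∈ J, r ≤ t → ∀ j,
      ∃ c, Tendsto (fun ζ => (φ t r (slitMap (w j) (b j) ζ)).im) outerNhds (𝓝 c) := by
    intro t ht hrt j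
    obtain ⟨N', w', b', hw', hD'⟩ := (h.slit t ht).exists_isSlitFamily
    exact exists_tendsto_im_slit (w' := w') (b' := b') hw (hD ▸ hD' ▸ h.mapsTo r hr t ht hrt)
      (hd t ht hrt) (hD ▸ h.inj r hr t ht hrt) (hD ▸ hD' ▸ h.h3 r hr t ht hrt)
      (hD ▸ h.h1 r hr t ht hrt) j
  obtain ⟨ηu, hηu, hiu⟩ := (h.h1 r hr u hu hru).exists_norm_le
  obtain ⟨ηs, hηs, his⟩ := (h.h1 r hr s hs hrs).exists_norm_le
  have hinf : ∀ ε > 0, ∃ R, ∀ z : ℂ, max ηu ηs + 1 ≤ z.im → R < ‖z‖ →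
      ‖φ u r z - φ s r z‖ ≤ ε := by
    intro ε hε
    obtain ⟨R₁, h₁⟩ := hiu (max ηu ηs + 1) (by linarith [le_max_left ηu ηs]) _ (half_pos hε)
    obtain ⟨R₂, h₂⟩ := his (max ηu ηs + 1) (by linarith [le_max_right ηu ηs]) _ (half_pos hε)
    refine ⟨max R₁ R₂, fun z hz hzR => ?_⟩
    rw [← sub_sub_sub_cancel_right _ _ z]
    linarith [_root_.norm_sub_le (φ u r z - z) (φ s r z - z),
      h₁ z hz ((le_max_left _ _).trans_lt hzR), h₂ z hz ((le_max_right _ _).trans_lt hzR)]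
  have hηw : ∀ j, η < (w j).im := by
    intro j
    refine hηD.trans_le (csInf_le ⟨0, ?_⟩ ⟨w j, ⟨hw.im_pos j, fun hj => ?_⟩, rfl⟩)
    · rintro _ ⟨p, hp, rfl⟩
      exact le_of_lt hp.1
    · rw [hD] at hj
      exact hj.2 (mem_iUnion.2 ⟨j, ⟨rfl, by simpa using (hw.pos j).le⟩⟩)
  rw [hD] at him hz
  refine hw.norm_le_of_residue ((hd u hu hru).sub (hd s hs hrs)) him (fun j => ?_) hinf hγ hη hηw hz hzη
  obtain ⟨c₁, hc₁⟩ := hc u hu hru j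
  obtain ⟨c₂, hc₂⟩ := hc s hs hrs j
  exact ⟨c₁ - c₂, by simpa using hc₁.sub hc₂⟩

end

/-- quantitative Lipschitz continuity (w.r.t. `λ`) of
`t ↦ φ t t₀` on `D t₀ ∩ ℍ_η`. -/
theorem statement2 {T : ℝ} (hT : 0 < T) {I : Set ℝ}
    (hI : I = Set.Ico 0 T ∨ I = Set.Icc 0 T)
    {D : ℝ → Set ℂ} {φ : ℝ → ℝ → ℂ → ℂ} {lam : ℝ → ℂ}
    (hEF : IsEvolutionFamily I D φ lam)
    {t₀ : ℝ} (ht₀ : t₀ ∈ I) (ht₀T : t₀ < T) :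
    ∀ η : ℝ, 0 < η → η < etaD (D t₀) →
      ∀ z ∈ D t₀, η < z.im →
        ∀ s ∈ I, ∀ u ∈ I, t₀ ≤ s → s ≤ u →
          ‖φ u t₀ z - φ s t₀ z‖ ≤ 12 / η * ((lam u).re - (lam s).re) := by
  have h0 : (0 : ℝ) ∈ I := by
    rcases hI with rfl | rfl
    · exact ⟨le_rfl, hT⟩
    · exact ⟨le_rfl, hT.le⟩
  have ht₀0 : 0 ≤ t₀ := by
    rcases hI with rfl | rfl
    · exact ht₀.1
    · exact ht₀.1
  intro η hη hηD z hz hzη s hs u hu hs₀ hsu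
  exact hEF.norm_sub_le h0 ht₀ hs hu ht₀0 hs₀ hsu hη hηD hz hzη
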